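/- arXiv:math/0404418 — 8 statements merged into one kernel-verified Lean document; each statement's English description precedes it below -/
import Mathlib

section
/- The function ξ satisfies the differential equation (1/2)ξ''(t)·cos²t − ξ'(t)·cos t·sin t − ξ(t) = 2cos²t for all t in the open interval (−π/2, π/2). -/
open Real Set Filter Topology

noncomputable def xi (t : ℝ) : ℝ :=
  (Real.cos t ^ 2 + 2 * t * Real.sin t * Real.cos t + t ^ 2 - Real.pi ^ 2 / 4) / Real.cos t ^ 2

noncomputable def eta (t : ℝ) : ℝ :=
  ((4 / Real.pi) * t + (4 / Real.pi) * Real.cos t * Real.sin t - 2 * Real.sin t) / Real.cos t ^ 2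

theorem hasDerivAt_xi_numerator (t : ℝ) :
    HasDerivAt (fun t : ℝ => Real.cos t ^ 2 + 2 * t * Real.sin t * Real.cos t + t ^ 2
      - Real.pi ^ 2 / 4) (4 * t * Real.cos t ^ 2) t := by
  have hc := Real.hasDerivAt_cos t
  have hs := Real.hasDerivAt_sin t
  have ht := hasDerivAt_id' t
  refine ((((hc.fun_pow 2).fun_add (((ht.const_mul 2).fun_mul hs).fun_mul hc)).fun_add
    (ht.fun_pow 2)).sub_const (Real.pi ^ 2 / 4)).congr_deriv ?_
  have h := Real.sin_sq_add_cos_sq t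
  push_cast
  linear_combination -2 * t * h

theorem hasDerivAt_xi {t : ℝ} (h0 : Real.cos t ≠ 0) :
    HasDerivAt xi (4 * t + 2 * (xi t * (Real.sin t / Real.cos t))) t := by
  refine ((hasDerivAt_xi_numerator t).fun_div ((Real.hasDerivAt_cos t).fun_pow 2)
    (pow_ne_zero 2 h0)).congr_deriv ?_
  unfold xi
  field_simp
  push_cast
  ring

theorem hasDerivAt_deriv_xi {t : ℝ} (h0 : Real.cos t ≠ 0) :
    HasDerivAt (deriv xi)
      (4 + 2 * ((4 * t + 2 * (xi t * (Real.sin t / Real.cos t))) * (Real.sin t / Real.cos t)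
        + xi t * (1 / Real.cos t ^ 2))) t := by
  have hev : deriv xi =ᶠ[𝓝 t]
      fun u => 4 * u + 2 * (xi u * (Real.sin u / Real.cos u)) := by
    filter_upwards [Real.continuous_cos.continuousAt.eventually_ne h0] with u hu
    exact (hasDerivAt_xi hu).deriv
  refine HasDerivAt.congr_of_eventuallyEq ?_ hev
  have htan : HasDerivAt (fun u => Real.sin u / Real.cos u) (1 / Real.cos t ^ 2) t := by
    simpa only [← Real.tan_eq_sin_div_cos] using Real.hasDerivAt_tan h0
  simpa using ((hasDerivAt_id' t).const_mul 4).fun_add (((hasDerivAt_xi h0).fun_mul htan).const_mul 2)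

theorem xi_ode :
    ∀ t ∈ Set.Ioo (-(Real.pi / 2)) (Real.pi / 2),
      (1 / 2) * deriv (deriv xi) t * Real.cos t ^ 2
        - deriv xi t * Real.cos t * Real.sin t - xi t = 2 * Real.cos t ^ 2 := by
  intro t ht
  have h0 : Real.cos t ≠ 0 := (Real.cos_pos_of_mem_Ioo ht).ne'
  rw [(hasDerivAt_deriv_xi h0).deriv, (hasDerivAt_xi h0).deriv]
  field_simp
  ring
end

section
/- For all t in (−π/2, π/2) one has 1 − π²/4 ≤ ξ(t) ≤ 0, the minimum value is attained at t = 0 where ξ(0) = 1 − π²/4, and ξ(t) < 0 for all t in (−π/2, π/2). -/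
open Real Set Filter Topology

/-- Sine and cosine combined as `4 * x * cos x - k * sin x` lie above their chords from the origin. -/
lemma chord_le_mul_cos_sub_sin {k : ℝ} (hk : k ≤ 8) {x a : ℝ} (hx : x ∈ Icc 0 (π / 2))
    (ha : a ∈ Icc (0 : ℝ) 1) :
    a * (4 * x * cos x - k * sin x) ≤ 4 * (a * x) * cos (a * x) - k * sin (a * x) := by
  have hd : ∀ y : ℝ, HasDerivAt (fun y => 4 * y * cos y - k * sin y)
      ((4 - k) * cos y - 4 * y * sin y) y := fun y => by
    refine HasDerivAt.congr_deriv ((((hasDerivAt_id y).const_mul 4).mul (hasDerivAt_cos y)).sub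
      ((hasDerivAt_sin y).const_mul k)) ?_
    simp only [id]; ring
  have hd' : ∀ y : ℝ, HasDerivAt (fun y => (4 - k) * cos y - 4 * y * sin y)
      (-((8 - k) * sin y + 4 * y * cos y)) y := fun y => by
    refine HasDerivAt.congr_deriv (((hasDerivAt_cos y).const_mul (4 - k)).sub
      (((hasDerivAt_id y).const_mul 4).mul (hasDerivAt_sin y))) ?_
    simp only [id]; ring
  have hconc : ConcaveOn ℝ (Icc 0 (π / 2)) (fun y => 4 * y * cos y - k * sin y) := by
    refine concaveOn_of_hasDerivWithinAt2_nonpos (convex_Icc _ _) (by fun_prop)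
      (fun y _ => (hd y).hasDerivWithinAt) (fun y _ => (hd' y).hasDerivWithinAt) fun y hy => ?_
    rw [interior_Icc] at hy
    have hs := sin_nonneg_of_nonneg_of_le_pi hy.1.le (by linarith [hy.2, pi_pos])
    have hc := cos_nonneg_of_neg_pi_div_two_le_of_le (by linarith [hy.1, pi_pos]) hy.2.le
    have := mul_nonneg (sub_nonneg.2 hk) hs
    have := mul_nonneg hy.1.le hc
    linarith
  have h := hconc.2 hx (left_mem_Icc.2 (by positivity)) ha.1 (sub_nonneg.2 ha.2) (by ring)
  simpa using h

/-- On `[0, π / 2]`, `t ^ 2 + 2 * t * sin t * cos t` dominates its endpoint-matching multiple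
of `sin t ^ 2`. -/
lemma pi_sq_div_four_mul_sin_sq_le {t : ℝ} (ht : t ∈ Icc 0 (π / 2)) :
    π ^ 2 / 4 * sin t ^ 2 ≤ t ^ 2 + 2 * t * sin t * cos t := by
  have hk : π ^ 2 / 2 - 2 ≤ 8 := by nlinarith [pi_lt_four, pi_pos]
  let g : ℝ → ℝ := fun x => x ^ 2 + 2 * x * sin x * cos x - π ^ 2 / 4 * sin x ^ 2
  have hd : ∀ x : ℝ, HasDerivAt g (cos x * (4 * x * cos x - (π ^ 2 / 2 - 2) * sin x)) x :=
    fun x => by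
    refine HasDerivAt.congr_deriv ((((hasDerivAt_id x).pow 2).add
      ((((hasDerivAt_id x).const_mul 2).mul (hasDerivAt_sin x)).mul (hasDerivAt_cos x))).sub
      (((hasDerivAt_sin x).pow 2).const_mul (π ^ 2 / 4))) ?_
    simp only [id, Pi.mul_apply]
    push_cast
    linear_combination (-2 * x) * sin_sq_add_cos_sq x
  have hg : Continuous g := by fun_prop
  have hcos : ∀ x ∈ Icc 0 (π / 2), 0 ≤ cos x := fun x hx =>
    cos_nonneg_of_neg_pi_div_two_le_of_le (by linarith [hx.1, pi_pos]) hx.2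
  suffices h : 0 ≤ g t by simp only [g] at h; linarith
  rcases le_or_gt 0 (4 * t * cos t - (π ^ 2 / 2 - 2) * sin t) with hp | hp
  · have hmono : MonotoneOn g (Icc 0 t) :=
      monotoneOn_of_hasDerivWithinAt_nonneg (convex_Icc _ _) hg.continuousOn
        (fun x _ => (hd x).hasDerivWithinAt) fun x hx => by
          rw [interior_Icc] at hx
          have ht0 : 0 < t := hx.1.trans hx.2
          have h := chord_le_mul_cos_sub_sin hk ht
            ⟨div_nonneg hx.1.le ht.1, div_le_one_of_le₀ hx.2.le ht.1⟩
          rw [div_mul_cancel₀ _ ht0.ne'] at h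
          exact mul_nonneg (hcos x ⟨hx.1.le, hx.2.le.trans ht.2⟩)
            ((mul_nonneg (div_nonneg hx.1.le ht.1) hp).trans h)
    have h := hmono (left_mem_Icc.2 ht.1) (right_mem_Icc.2 ht.1) ht.1
    simpa [g] using h
  · have hanti : AntitoneOn g (Icc t (π / 2)) :=
      antitoneOn_of_hasDerivWithinAt_nonpos (convex_Icc _ _) hg.continuousOn
        (fun x _ => (hd x).hasDerivWithinAt) fun x hx => by
          rw [interior_Icc] at hx
          have hx0 : 0 < x := ht.1.trans_lt hx.1
          have hx' : x ∈ Icc 0 (π / 2) := ⟨hx0.le, hx.2.le⟩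
          have h := chord_le_mul_cos_sub_sin hk hx'
            ⟨div_nonneg ht.1 hx0.le, div_le_one_of_le₀ hx.1.le hx0.le⟩
          rw [div_mul_cancel₀ _ hx0.ne'] at h
          refine mul_nonpos_of_nonneg_of_nonpos (hcos x hx') ?_
          by_contra! hpos
          exact (h.trans_lt hp).not_ge (mul_nonneg (div_nonneg ht.1 hx0.le) hpos.le)
    have h := hanti (left_mem_Icc.2 ht.2) (right_mem_Icc.2 ht.2) ht.2
    refine le_trans (le_of_eq ?_) h
    simp only [g, cos_pi_div_two, sin_pi_div_two]
    ring

lemma cos_sq_add_lt_pi_sq_div_four {t : ℝ} (ht : t ∈ Ico 0 (π / 2)) :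
    cos t ^ 2 + 2 * t * sin t * cos t + t ^ 2 < π ^ 2 / 4 := by
  let g : ℝ → ℝ := fun x => cos x ^ 2 + 2 * x * sin x * cos x + x ^ 2
  have hd : ∀ x : ℝ, HasDerivAt g (4 * x * cos x ^ 2) x := fun x => by
    refine HasDerivAt.congr_deriv ((((hasDerivAt_cos x).pow 2).add
      ((((hasDerivAt_id x).const_mul 2).mul (hasDerivAt_sin x)).mul (hasDerivAt_cos x))).add
      ((hasDerivAt_id x).pow 2)) ?_
    simp only [id, Pi.mul_apply]
    push_cast
    linear_combination (-2 * x) * sin_sq_add_cos_sq x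
  have hg : Continuous g := by fun_prop
  have hmono : StrictMonoOn g (Icc 0 (π / 2)) :=
    strictMonoOn_of_hasDerivWithinAt_pos (convex_Icc _ _) hg.continuousOn
      (fun x _ => (hd x).hasDerivWithinAt) fun x hx => by
        rw [interior_Icc] at hx
        have hx0 := hx.1
        have hc := cos_pos_of_mem_Ioo ⟨by linarith [pi_pos], hx.2⟩
        positivity
  have h := hmono ⟨ht.1, ht.2.le⟩ (right_mem_Icc.2 (by positivity)) ht.2
  simp only [g, cos_pi_div_two, sin_pi_div_two] at h
  linarith

lemma xi_neg (t : ℝ) : xi (-t) = xi t := by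
  simp [xi]

lemma xi_abs (t : ℝ) : xi |t| = xi t := by
  rcases abs_choice t with h | h <;> simp [h, xi_neg]

lemma xi_lt_zero {t : ℝ} (ht : t ∈ Ioo (-(π / 2)) (π / 2)) : xi t < 0 := by
  have hc : 0 < cos |t| := by rw [cos_abs]; exact cos_pos_of_mem_Ioo ht
  rw [← xi_abs]
  refine div_neg_of_neg_of_pos ?_ (by positivity)
  linarith [cos_sq_add_lt_pi_sq_div_four ⟨abs_nonneg t, abs_lt.2 ht⟩]

lemma le_xi {t : ℝ} (ht : t ∈ Ioo (-(π / 2)) (π / 2)) : 1 - π ^ 2 / 4 ≤ xi t := by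
  have hc : 0 < cos |t| := by rw [cos_abs]; exact cos_pos_of_mem_Ioo ht
  rw [← xi_abs, xi, le_div_iff₀ (by positivity)]
  have h := pi_sq_div_four_mul_sin_sq_le ⟨abs_nonneg t, (abs_lt.2 ht).le⟩
  rw [sin_sq] at h
  linarith

theorem xi_bounds :
    (∀ t ∈ Set.Ioo (-(Real.pi / 2)) (Real.pi / 2),
      1 - Real.pi ^ 2 / 4 ≤ xi t ∧ xi t ≤ 0) ∧
    xi 0 = 1 - Real.pi ^ 2 / 4 ∧
    (∀ t ∈ Set.Ioo (-(Real.pi / 2)) (Real.pi / 2), xi t < 0) := by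
  exact ⟨fun t ht => ⟨le_xi ht, (xi_lt_zero ht).le⟩, by simp [xi], fun t ht => xi_lt_zero ht⟩
end

section
/- The function t ↦ ξ'(t)/t is strictly increasing on (0, π/2), and 2(3 − π²/4) ≤ ξ'(t)/t ≤ 4/3 for all nonzero t in (−π/2, π/2). -/
open Real Set Filter Topology

/-- On `(0, a)`, once `g` is nonnegative it stays positive: its sign changes at most once,
from negative to positive. -/
def SignUp (a : ℝ) (g : ℝ → ℝ) : Prop :=
  ∀ s t, 0 < s → s < t → t < a → 0 ≤ g s → 0 < g t

section SignPatterns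

variable {a : ℝ} {f g p : ℝ → ℝ}

lemma lt_of_nonneg_of_signUp (hf : ∀ t, HasDerivAt f (p t * g t) t)
    (hp : ∀ t, 0 < t → t < a → 0 < p t) (hg : SignUp a g) {r s t : ℝ}
    (hr : 0 < r) (hgr : 0 ≤ g r) (hrs : r ≤ s) (hst : s < t) (ht : t ≤ a) : f s < f t := by
  obtain ⟨c, hc, hce⟩ := exists_hasDerivAt_eq_slope f (fun t => p t * g t) hst
    (fun x _ => (hf x).continuousAt.continuousWithinAt) (fun x _ => hf x)
  have hca : c < a := hc.2.trans_le ht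
  have hrc : r < c := hrs.trans_lt hc.1
  have hpos : 0 < p c * g c := mul_pos (hp c (hr.trans hrc) hca) (hg r c hr hrc hca hgr)
  rw [hce, div_pos_iff_of_pos_right (sub_pos.2 hst)] at hpos
  linarith

lemma exists_nonneg_of_le (hf : ∀ t, HasDerivAt f (p t * g t) t)
    (hp : ∀ t, 0 < t → t < a → 0 < p t) {s t : ℝ}
    (hs : 0 ≤ s) (hst : s < t) (ht : t ≤ a) (h : f s ≤ f t) :
    ∃ r, s < r ∧ r < t ∧ 0 ≤ g r := by
  obtain ⟨c, hc, hce⟩ := exists_hasDerivAt_eq_slope f (fun t => p t * g t) hst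
    (fun x _ => (hf x).continuousAt.continuousWithinAt) (fun x _ => hf x)
  refine ⟨c, hc.1, hc.2, ?_⟩
  have hpos : 0 ≤ p c * g c := by
    rw [hce]
    exact div_nonneg (by linarith) (by linarith)
  exact nonneg_of_mul_nonneg_right hpos (hp c (hs.trans_lt hc.1) (hc.2.trans_le ht))

lemma SignUp.of_deriv (hf : ∀ t, HasDerivAt f (p t * g t) t)
    (hp : ∀ t, 0 < t → t < a → 0 < p t) (hg : SignUp a g) (h0 : f 0 ≤ 0) : SignUp a f := by
  intro s t hs hst hta hfs
  obtain ⟨r, hr0, hrs, hgr⟩ := exists_nonneg_of_le hf hp le_rfl hs (hst.trans hta).le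
    (h0.trans hfs)
  exact hfs.trans_lt (lt_of_nonneg_of_signUp hf hp hg hr0 hgr hrs.le hst hta.le)

lemma SignUp.neg_of_deriv (hf : ∀ t, HasDerivAt f (p t * g t) t)
    (hp : ∀ t, 0 < t → t < a → 0 < p t) (hg : SignUp a g) (ha : f a ≤ 0) :
    SignUp a (fun t => -f t) := by
  intro s t hs hst hta hfs
  by_contra! hft
  obtain ⟨r, hsr, hrt, hgr⟩ := exists_nonneg_of_le hf hp hs.le hst hta.le (by linarith)
  have := lt_of_nonneg_of_signUp hf hp hg (hs.trans hsr) hgr hrt.le hta le_rfl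
  linarith

lemma SignUp.neg_of_endpoints (hf : ∀ t, HasDerivAt f (p t * g t) t)
    (hp : ∀ t, 0 < t → t < a → 0 < p t) (hg : SignUp a g) (h0 : f 0 ≤ 0) (ha : f a ≤ 0)
    {t : ℝ} (ht : 0 < t) (hta : t < a) : f t < 0 := by
  by_contra! hft
  obtain ⟨r, hr0, hrt, hgr⟩ := exists_nonneg_of_le hf hp le_rfl ht hta.le (h0.trans hft)
  have := lt_of_nonneg_of_signUp hf hp hg hr0 hgr hrt.le hta le_rfl
  linarith

end SignPatterns

/-- The derivative of `xi` is `2 * xiNum / cos ^ 3`. -/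
noncomputable def xiNum (t : ℝ) : ℝ :=
  sin t * (1 - sin t ^ 2) + 2 * t * cos t + (t ^ 2 - (π / 2) ^ 2) * sin t

noncomputable def xiQuad (t : ℝ) : ℝ := 3 * (1 - sin t ^ 2) + t ^ 2 - (π / 2) ^ 2

/-- Up to the positive factor `3 + 9 * sin ^ 2`, the numerator of the third derivative of `xi`. -/
noncomputable def xiThirdNum (t : ℝ) : ℝ :=
  xiNum t + (5 * sin t * (1 - sin t ^ 2) * xiQuad t + 2 * t * cos t * (1 - sin t ^ 2)
    - 6 * sin t * (1 - sin t ^ 2) ^ 2) / (3 + 9 * sin t ^ 2)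

noncomputable def auxS (t : ℝ) : ℝ :=
  xiQuad t + (2 * t * sin t * cos t * (3 * sin t ^ 2 - 1)
    - (1 - sin t ^ 2) * (3 * sin t ^ 2 - 1) ^ 2) / (2 - 3 * sin t ^ 2 + 3 * sin t ^ 4)

noncomputable def auxY (t : ℝ) : ℝ :=
  t - 3 * sin t * cos t * (1 + sin t ^ 2) / (2 + 3 * sin t ^ 2 - 3 * sin t ^ 4)

lemma cos_sq_eq (t : ℝ) : cos t ^ 2 = 1 - sin t ^ 2 := by
  linarith [sin_sq_add_cos_sq t]

lemma hasDerivAt_xiNum (t : ℝ) : HasDerivAt xiNum (cos t * xiQuad t) t := by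
  have hs := hasDerivAt_sin t
  have hc := hasDerivAt_cos t
  have hi := hasDerivAt_id' t
  have h := ((hs.mul ((hs.pow 2).const_sub 1)).add ((hi.const_mul 2).mul hc)).add
    (((hi.pow 2).sub_const ((π / 2) ^ 2)).mul hs)
  refine h.congr_deriv ?_
  simp [xiQuad]
  grind [cos_sq_eq t]

lemma hasDerivAt_xiQuad (t : ℝ) : HasDerivAt xiQuad (2 * t - 6 * sin t * cos t) t := by
  have hs := hasDerivAt_sin t
  have hi := hasDerivAt_id' t
  have h := ((((hs.pow 2).const_sub 1).const_mul 3).add (hi.pow 2)).sub_const ((π / 2) ^ 2)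
  refine h.congr_deriv ?_
  simp
  ring

lemma denom_S_pos (t : ℝ) : 0 < 2 - 3 * sin t ^ 2 + 3 * sin t ^ 4 := by
  nlinarith [sq_nonneg (2 * sin t ^ 2 - 1)]

lemma denom_Y_pos (t : ℝ) : 0 < 2 + 3 * sin t ^ 2 - 3 * sin t ^ 4 := by
  nlinarith [cos_sq_eq t, mul_nonneg (sq_nonneg (sin t)) (sq_nonneg (cos t))]

lemma hasDerivAt_auxY (t : ℝ) : HasDerivAt auxY
    (1 / (2 + 3 * sin t ^ 2 - 3 * sin t ^ 4) ^ 2 *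
      (9 * sin t ^ 8 + 9 * sin t ^ 6 - 15 * sin t ^ 4 + 15 * sin t ^ 2 - 2)) t := by
  have hs := hasDerivAt_sin t
  have hc := hasDerivAt_cos t
  have hi := hasDerivAt_id' t
  have hd := (denom_Y_pos t).ne'
  have h := hi.sub ((((hs.const_mul 3).mul hc).mul ((hs.pow 2).const_add 1)).div
    ((((hs.pow 2).const_mul 3).const_add 2).sub ((hs.pow 4).const_mul 3)) hd)
  refine h.congr_deriv ?_
  have hcs := cos_sq_eq t
  simp
  generalize sin t = s at *
  generalize cos t = c at *
  field_simp
  grind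

lemma hasDerivAt_auxS (t : ℝ) : HasDerivAt auxS
    (2 * cos t ^ 2 * (1 + 3 * sin t ^ 2) * (2 + 3 * sin t ^ 2 - 3 * sin t ^ 4) /
      (2 - 3 * sin t ^ 2 + 3 * sin t ^ 4) ^ 2 * auxY t) t := by
  have hs := hasDerivAt_sin t
  have hc := hasDerivAt_cos t
  have hi := hasDerivAt_id' t
  have hd := (denom_S_pos t).ne'
  have hd' := (denom_Y_pos t).ne'
  have h := (hasDerivAt_xiQuad t).add
    ((((((hi.const_mul 2).mul hs).mul hc).mul (((hs.pow 2).const_mul 3).sub_const 1)).sub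
      (((hs.pow 2).const_sub 1).mul ((((hs.pow 2).const_mul 3).sub_const 1).pow 2))).div
    ((((hs.pow 2).const_mul 3).const_sub 2).add ((hs.pow 4).const_mul 3)) hd)
  refine h.congr_deriv ?_
  have hcs := cos_sq_eq t
  simp [auxY]
  generalize sin t = s at *
  generalize cos t = c at *
  field_simp
  grind

lemma hasDerivAt_neg_xiThirdNum (t : ℝ) : HasDerivAt (fun t => -xiThirdNum t)
    (12 * cos t * (2 - 3 * sin t ^ 2 + 3 * sin t ^ 4) / (3 + 9 * sin t ^ 2) ^ 2 * -auxS t) t := by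
  have hs := hasDerivAt_sin t
  have hc := hasDerivAt_cos t
  have hi := hasDerivAt_id' t
  have hd := (denom_S_pos t).ne'
  have hw : 3 + 9 * sin t ^ 2 ≠ 0 := by positivity
  have h := ((hasDerivAt_xiNum t).add
    ((((((hs.const_mul 5).mul ((hs.pow 2).const_sub 1)).mul (hasDerivAt_xiQuad t)).add
      (((hi.const_mul 2).mul hc).mul ((hs.pow 2).const_sub 1))).sub
      ((hs.const_mul 6).mul (((hs.pow 2).const_sub 1).pow 2))).div
    (((hs.pow 2).const_mul 9).const_add 3) hw)).neg
  refine h.congr_deriv ?_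
  have hcs := cos_sq_eq t
  simp [auxS]
  generalize xiQuad t = P at *
  generalize sin t = s at *
  generalize cos t = c at *
  field_simp
  grind

lemma cos_pos_of_mem {t : ℝ} (h0 : 0 < t) (h1 : t < π / 2) : 0 < cos t :=
  cos_pos_of_mem_Ioo ⟨by linarith, h1⟩

lemma sin_sq_lt {s t : ℝ} (hs : 0 < s) (hst : s < t) (ht : t < π / 2) :
    sin s ^ 2 < sin t ^ 2 := by
  have h1 : 0 < sin s := sin_pos_of_pos_of_lt_pi hs (by linarith)
  have h2 : sin s < sin t := sin_lt_sin_of_lt_of_le_pi_div_two (by linarith) ht.le hst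
  gcongr

lemma quartic_lt {x y : ℝ} (hx : 0 ≤ x) (hxy : x < y) :
    9 * x ^ 4 + 9 * x ^ 3 - 15 * x ^ 2 + 15 * x - 2
      < 9 * y ^ 4 + 9 * y ^ 3 - 15 * y ^ 2 + 15 * y - 2 := by
  have hy : 0 < y := hx.trans_lt hxy
  have hq : 0 < 9 * (x ^ 2 + y ^ 2) * (x + y) + 9 * (x ^ 2 + x * y + y ^ 2)
      - 15 * (x + y) + 15 := by
    have : 0 ≤ 9 * (x ^ 2 + y ^ 2) * (x + y) := by positivity
    nlinarith [sq_nonneg (x - y), sq_nonneg (x + y - 10 / 9)]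
  nlinarith [mul_pos (sub_pos.2 hxy) hq]

lemma signUp_auxY : SignUp (π / 2) auxY := by
  refine SignUp.of_deriv hasDerivAt_auxY
    (fun t _ _ => by have := denom_Y_pos t; positivity) ?_ (by simp [auxY])
  intro s t hs hst ht h
  have := quartic_lt (sq_nonneg (sin s)) (sin_sq_lt hs hst ht)
  ring_nf at this h ⊢
  linarith

lemma xiThirdNum_pos {t : ℝ} (h0 : 0 < t) (h1 : t < π / 2) : 0 < xiThirdNum t := by
  have hS : SignUp (π / 2) (fun t => -auxS t) :=
    SignUp.neg_of_deriv hasDerivAt_auxS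
      (fun t h0 h1 => by
        have := denom_Y_pos t
        have := denom_S_pos t
        have := cos_pos_of_mem h0 h1
        positivity) signUp_auxY (by simp [auxS, xiQuad])
  have := SignUp.neg_of_endpoints hasDerivAt_neg_xiThirdNum
    (fun t h0 h1 => by
      have := denom_S_pos t
      have := cos_pos_of_mem h0 h1
      positivity) hS (by simp [xiThirdNum, xiNum]) (by simp [xiThirdNum, xiNum]) h0 h1
  linarith

noncomputable def xiDeriv (t : ℝ) : ℝ := 2 * xiNum t / cos t ^ 3

noncomputable def xiSecond (t : ℝ) : ℝ :=
  2 * (cos t ^ 2 * xiQuad t + 3 * sin t * xiNum t) / cos t ^ 4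

lemma hasDerivAt_xi_s7 {t : ℝ} (hc : cos t ≠ 0) : HasDerivAt xi (xiDeriv t) t := by
  have hs := hasDerivAt_sin t
  have hc' := hasDerivAt_cos t
  have hi := hasDerivAt_id' t
  have h := ((((hc'.pow 2).add (((hi.const_mul 2).mul hs).mul hc')).add (hi.pow 2)).sub_const
    (π ^ 2 / 4)).div (hc'.pow 2) (pow_ne_zero 2 hc)
  refine h.congr_deriv ?_
  have hcs := cos_sq_eq t
  simp [xiDeriv, xiNum]
  generalize sin t = s at *
  generalize cos t = c at *
  field_simp
  grind

lemma hasDerivAt_xiDeriv {t : ℝ} (hc : cos t ≠ 0) : HasDerivAt xiDeriv (xiSecond t) t := by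
  have h := ((hasDerivAt_xiNum t).const_mul 2).div ((hasDerivAt_cos t).pow 3) (pow_ne_zero 3 hc)
  refine h.congr_deriv ?_
  simp [xiSecond]
  field_simp

lemma hasDerivAt_xiSecond {t : ℝ} (hc : cos t ≠ 0) :
    HasDerivAt xiSecond (2 * (3 + 9 * sin t ^ 2) * xiThirdNum t / cos t ^ 5) t := by
  have hs := hasDerivAt_sin t
  have hc' := hasDerivAt_cos t
  have hw : 3 + 9 * sin t ^ 2 ≠ 0 := by positivity
  have h := ((((hc'.pow 2).mul (hasDerivAt_xiQuad t)).add
    ((hs.const_mul 3).mul (hasDerivAt_xiNum t))).const_mul 2).div (hc'.pow 4) (pow_ne_zero 4 hc)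
  refine h.congr_deriv ?_
  have hcs := cos_sq_eq t
  simp [xiThirdNum]
  generalize xiQuad t = P at *
  generalize xiNum t = N at *
  generalize sin t = s at *
  generalize cos t = c at *
  field_simp
  grind

lemma xiSecond_lt {s t : ℝ} (hs : 0 ≤ s) (hst : s < t) (ht : t < π / 2) :
    xiSecond s < xiSecond t := by
  have hmono : StrictMonoOn xiSecond (Ico 0 (π / 2)) := by
    have hc : ∀ x ∈ Ico 0 (π / 2), 0 < cos x := fun x hx =>
      cos_pos_of_mem_Ioo ⟨by linarith [hx.1, pi_pos], hx.2⟩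
    refine strictMonoOn_of_deriv_pos (convex_Ico _ _)
      (fun x hx => (hasDerivAt_xiSecond (hc x hx).ne').continuousAt.continuousWithinAt) ?_
    intro x hx
    rw [interior_Ico] at hx
    have hcx := cos_pos_of_mem hx.1 hx.2
    rw [(hasDerivAt_xiSecond hcx.ne').deriv]
    have := xiThirdNum_pos hx.1 hx.2
    positivity
  exact hmono ⟨hs, hst.trans ht⟩ ⟨hs.trans hst.le, ht⟩ hst

lemma exists_xiDeriv_div_eq {t : ℝ} (h0 : 0 < t) (h1 : t < π / 2) :
    ∃ r, 0 < r ∧ r < t ∧ xiDeriv t / t = xiSecond r := by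
  have hc : ∀ x ∈ Icc 0 t, cos x ≠ 0 := fun x hx =>
    (cos_pos_of_mem_Ioo ⟨by linarith [hx.1, pi_pos], by linarith [hx.2]⟩).ne'
  obtain ⟨r, hr, he⟩ := exists_hasDerivAt_eq_slope xiDeriv xiSecond h0
    (fun x hx => (hasDerivAt_xiDeriv (hc x hx)).continuousAt.continuousWithinAt)
    (fun x hx => hasDerivAt_xiDeriv (hc x (Ioo_subset_Icc_self hx)))
  refine ⟨r, hr.1, hr.2, ?_⟩
  rw [he]
  simp [xiDeriv, xiNum]

lemma xiDeriv_div_strictMonoOn :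
    StrictMonoOn (fun t => xiDeriv t / t) (Ioo 0 (π / 2)) := by
  have hd : ∀ x ∈ Ioo 0 (π / 2),
      HasDerivAt (fun t => xiDeriv t / t) ((xiSecond x * x - xiDeriv x * 1) / x ^ 2) x :=
    fun x hx => (hasDerivAt_xiDeriv (cos_pos_of_mem hx.1 hx.2).ne').div
      (hasDerivAt_id' x) hx.1.ne'
  refine strictMonoOn_of_deriv_pos (convex_Ioo _ _)
    (fun x hx => (hd x hx).continuousAt.continuousWithinAt) ?_
  intro x hx
  rw [interior_Ioo] at hx
  rw [(hd x hx).deriv]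
  obtain ⟨r, hr0, hrx, he⟩ := exists_xiDeriv_div_eq hx.1 hx.2
  have hlt := xiSecond_lt hr0.le hrx hx.2
  rw [← he, div_lt_iff₀ hx.1] at hlt
  exact div_pos (by linarith) (pow_pos hx.1 2)

lemma le_xiDeriv_div {t : ℝ} (h0 : 0 < t) (h1 : t < π / 2) :
    2 * (3 - π ^ 2 / 4) ≤ xiDeriv t / t := by
  obtain ⟨r, hr0, hrt, he⟩ := exists_xiDeriv_div_eq h0 h1
  have h := xiSecond_lt le_rfl hr0 (hrt.trans h1)
  have h2 : xiSecond 0 = 2 * (3 - π ^ 2 / 4) := by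
    simp [xiSecond, xiQuad]
    ring
  rw [he, ← h2]
  exact h.le

lemma xiNum_lt {t : ℝ} (h0 : 0 < t) (h1 : t < π / 2) : xiNum t < 2 / 3 * t * cos t ^ 3 := by
  have hM : SignUp (π / 2) (fun t => t * sin t - cos t / 3) := by
    refine SignUp.of_deriv (p := fun _ => 1) (g := fun t => 4 / 3 * sin t + t * cos t)
      (fun t => ?_) (fun _ _ _ => one_pos) ?_ (by simp)
    · refine (((hasDerivAt_id' t).mul (hasDerivAt_sin t)).sub
        ((hasDerivAt_cos t).div_const 3)).congr_deriv ?_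
      ring
    · intro s t hs hst ht _
      have := sin_pos_of_pos_of_lt_pi (hs.trans hst) (by linarith)
      have := cos_pos_of_mem (hs.trans hst) ht
      have := hs.trans hst
      positivity
  have hL : SignUp (π / 2) (fun t => 2 / 3 * sin t - t * cos t) := by
    refine SignUp.of_deriv (p := fun _ => 1) (fun t => ?_) (fun _ _ _ => one_pos) hM (by simp)
    refine (((hasDerivAt_sin t).const_mul (2 / 3)).sub
      ((hasDerivAt_id' t).mul (hasDerivAt_cos t))).congr_deriv ?_
    ring
  have hJ : SignUp (π / 2) (fun t =>
      -((π / 2) ^ 2 - t ^ 2 - 7 / 3 * cos t ^ 2 - 2 * t * cos t * sin t)) := by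
    refine SignUp.neg_of_deriv (p := fun t => 4 * cos t) (fun t => ?_)
      (fun t h0 h1 => by have := cos_pos_of_mem h0 h1; positivity) hL (by simp)
    have hi := hasDerivAt_id' t
    have hs := hasDerivAt_sin t
    have hc := hasDerivAt_cos t
    refine ((((hi.pow 2).const_sub _).sub ((hc.pow 2).const_mul (7 / 3))).sub
      (((hi.const_mul 2).mul hc).mul hs)).congr_deriv ?_
    simp
    grind [cos_sq_eq t]
  have hK := SignUp.neg_of_endpoints (f := fun t => xiNum t - 2 / 3 * t * cos t ^ 3)
    (p := cos) (fun t => ?_) (fun _ => cos_pos_of_mem) hJ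
    (by simp [xiNum]) (by simp [xiNum]) h0 h1
  · linarith
  · have hi := hasDerivAt_id' t
    have hc := hasDerivAt_cos t
    refine ((hasDerivAt_xiNum t).sub ((hi.const_mul (2 / 3)).mul (hc.pow 3))).congr_deriv ?_
    simp [xiQuad]
    grind [cos_sq_eq t]

lemma xiDeriv_div_le {t : ℝ} (h0 : 0 < t) (h1 : t < π / 2) : xiDeriv t / t ≤ 4 / 3 := by
  have hc := cos_pos_of_mem h0 h1
  have h := xiNum_lt h0 h1
  rw [xiDeriv, div_le_iff₀ h0, div_le_iff₀ (pow_pos hc 3)]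
  linarith

lemma xiDeriv_neg (t : ℝ) : xiDeriv (-t) = -xiDeriv t := by
  simp [xiDeriv, xiNum]
  ring

theorem xi_deriv_div_t :
    StrictMonoOn (fun t => deriv xi t / t) (Set.Ioo (0 : ℝ) (Real.pi / 2)) ∧
    (∀ t ∈ Set.Ioo (-(Real.pi / 2)) (Real.pi / 2), t ≠ 0 →
      2 * (3 - Real.pi ^ 2 / 4) ≤ deriv xi t / t ∧ deriv xi t / t ≤ 4 / 3) := by
  constructor
  · refine xiDeriv_div_strictMonoOn.congr fun t ht => ?_
    simp only [(hasDerivAt_xi_s7 (cos_pos_of_mem ht.1 ht.2).ne').deriv]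
  · intro t ht h0
    rw [(hasDerivAt_xi_s7 (cos_pos_of_mem_Ioo ht).ne').deriv]
    rcases h0.lt_or_gt with h | h
    · have hneg : xiDeriv t / t = xiDeriv (-t) / -t := by rw [xiDeriv_neg, neg_div_neg_eq]
      have h1 : 0 < -t := by linarith
      have h2 : -t < π / 2 := by linarith [ht.1]
      rw [hneg]
      exact ⟨le_xiDeriv_div h1 h2, xiDeriv_div_le h1 h2⟩
    · exact ⟨le_xiDeriv_div h ht.2, xiDeriv_div_le h ht.2⟩
end

section
/- The function q = ξ' satisfies the differential equation (1/2)q''(t)·cos t − 2q'(t)·sin t − 2q(t)·cos t = −4 sin t for all t in (−π/2, π/2). -/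
open Real Set Filter Topology

theorem hasDerivAt_inv_cos {t : ℝ} (h : Real.cos t ≠ 0) :
    HasDerivAt (fun x => (Real.cos x)⁻¹) (Real.sin t * (Real.cos t)⁻¹ ^ 2) t := by
  refine ((Real.hasDerivAt_cos t).inv h).congr_deriv ?_
  rw [inv_pow, div_eq_mul_inv, neg_neg]

theorem deriv_eq_of_hasDerivAt_on_cos_ne_zero {f g g' : ℝ → ℝ}
    (hfg : ∀ t, Real.cos t ≠ 0 → f t = g t)
    (hg : ∀ t, Real.cos t ≠ 0 → HasDerivAt g (g' t) t) {t : ℝ} (h : Real.cos t ≠ 0) :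
    deriv f t = g' t := by
  have hev : f =ᶠ[𝓝 t] g := by
    filter_upwards [Real.continuous_cos.continuousAt.eventually_ne h] with x hx using hfg x hx
  rw [hev.deriv_eq, (hg t h).deriv]

theorem deriv_xi {t : ℝ} (h : Real.cos t ≠ 0) :
    deriv xi t = 2 * (Real.sin t * (Real.cos t)⁻¹) + 4 * (t * (Real.cos t)⁻¹ ^ 2)
      + 2 * ((t ^ 2 - Real.pi ^ 2 / 4) * (Real.sin t * (Real.cos t)⁻¹ ^ 3)) := by
  refine deriv_eq_of_hasDerivAt_on_cos_ne_zero
    (g := fun x => 1 + 2 * (x * (Real.sin x * (Real.cos x)⁻¹))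
      + (x ^ 2 - Real.pi ^ 2 / 4) * (Real.cos x)⁻¹ ^ 2)
    (g' := fun t => 2 * (Real.sin t * (Real.cos t)⁻¹) + 4 * (t * (Real.cos t)⁻¹ ^ 2)
      + 2 * ((t ^ 2 - Real.pi ^ 2 / 4) * (Real.sin t * (Real.cos t)⁻¹ ^ 3)))
    (fun x hx => ?_) (fun x hx => ?_) h
  · simp only [xi]
    field_simp
    ring
  · have hu := hasDerivAt_inv_cos hx
    have hA := ((hasDerivAt_id' x).pow 2).sub_const (Real.pi ^ 2 / 4)
    refine (((((hasDerivAt_id' x).mul ((Real.hasDerivAt_sin x).mul hu)).const_mul 2).const_add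
      1).add (hA.mul (hu.pow 2))).congr_deriv ?_
    simp only [Pi.mul_apply, Pi.pow_apply, Nat.reduceSub, Nat.cast_ofNat]
    field_simp
    simp only [Real.sin_sq]
    ring

theorem deriv_deriv_xi {t : ℝ} (h : Real.cos t ≠ 0) :
    deriv (deriv xi) t = 6 * (Real.cos t)⁻¹ ^ 2 + 12 * (t * (Real.sin t * (Real.cos t)⁻¹ ^ 3))
      + (t ^ 2 - Real.pi ^ 2 / 4) * (6 * (Real.cos t)⁻¹ ^ 4 - 4 * (Real.cos t)⁻¹ ^ 2) := by
  refine deriv_eq_of_hasDerivAt_on_cos_ne_zero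
    (g' := fun t => 6 * (Real.cos t)⁻¹ ^ 2 + 12 * (t * (Real.sin t * (Real.cos t)⁻¹ ^ 3))
      + (t ^ 2 - Real.pi ^ 2 / 4) * (6 * (Real.cos t)⁻¹ ^ 4 - 4 * (Real.cos t)⁻¹ ^ 2))
    (fun x hx => deriv_xi hx) (fun x hx => ?_) h
  have hu := hasDerivAt_inv_cos hx
  have hs := Real.hasDerivAt_sin x
  have hA := ((hasDerivAt_id' x).pow 2).sub_const (Real.pi ^ 2 / 4)
  refine ((((hs.mul hu).const_mul 2).add (((hasDerivAt_id' x).mul (hu.pow 2)).const_mul 4)).add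
    ((hA.mul (hs.mul (hu.pow 3))).const_mul 2)).congr_deriv ?_
  simp only [Pi.mul_apply, Pi.pow_apply, Nat.reduceSub, Nat.cast_ofNat]
  field_simp
  simp only [Real.sin_sq]
  ring

theorem deriv_deriv_deriv_xi {t : ℝ} (h : Real.cos t ≠ 0) :
    deriv (deriv (deriv xi)) t = 24 * (Real.sin t * (Real.cos t)⁻¹ ^ 3)
      + t * (48 * (Real.cos t)⁻¹ ^ 4 - 32 * (Real.cos t)⁻¹ ^ 2)
      + (t ^ 2 - Real.pi ^ 2 / 4) *
        (Real.sin t * (24 * (Real.cos t)⁻¹ ^ 5 - 8 * (Real.cos t)⁻¹ ^ 3)) := by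
  refine deriv_eq_of_hasDerivAt_on_cos_ne_zero
    (g' := fun t => 24 * (Real.sin t * (Real.cos t)⁻¹ ^ 3)
      + t * (48 * (Real.cos t)⁻¹ ^ 4 - 32 * (Real.cos t)⁻¹ ^ 2)
      + (t ^ 2 - Real.pi ^ 2 / 4) *
        (Real.sin t * (24 * (Real.cos t)⁻¹ ^ 5 - 8 * (Real.cos t)⁻¹ ^ 3)))
    (fun x hx => deriv_deriv_xi hx) (fun x hx => ?_) h
  have hu := hasDerivAt_inv_cos hx
  have hs := Real.hasDerivAt_sin x
  have hA := ((hasDerivAt_id' x).pow 2).sub_const (Real.pi ^ 2 / 4)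
  refine ((((hu.pow 2).const_mul 6).add
    (((hasDerivAt_id' x).mul (hs.mul (hu.pow 3))).const_mul 12)).add
    (hA.mul (((hu.pow 4).const_mul 6).sub ((hu.pow 2).const_mul 4)))).congr_deriv ?_
  simp only [Pi.mul_apply, Pi.pow_apply, Pi.sub_apply, Nat.reduceSub, Nat.cast_ofNat]
  field_simp
  simp only [Real.sin_sq]
  ring

theorem q_ode :
    ∀ t ∈ Set.Ioo (-(Real.pi / 2)) (Real.pi / 2),
      (1 / 2) * deriv (deriv (deriv xi)) t * Real.cos t
        - 2 * deriv (deriv xi) t * Real.sin t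
        - 2 * deriv xi t * Real.cos t = -4 * Real.sin t := by
  intro t ht
  have h : Real.cos t ≠ 0 := (Real.cos_pos_of_mem_Ioo ht).ne'
  rw [deriv_deriv_deriv_xi h, deriv_deriv_xi h, deriv_xi h]
  field_simp
  ring_nf
  simp only [Real.sin_sq]
  ring
end

section
/- The function η satisfies the differential equation (1/2)η''(t)·cos²t − η'(t)·cos t·sin t − η(t) = −sin t for all t in the open interval (−π/2, π/2). -/
open Real Set Filter Topology

theorem hasDerivAt_eta {t : ℝ} (ht : Real.cos t ≠ 0) :
    HasDerivAt eta
      (8 / Real.pi - 2 / Real.cos t + 2 * (Real.sin t / Real.cos t) * eta t) t := by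
  have hs := Real.hasDerivAt_sin t
  have hc := Real.hasDerivAt_cos t
  have hnum := (((hasDerivAt_id t).const_mul (4 / Real.pi)).add
    ((hc.const_mul (4 / Real.pi)).mul hs)).sub (hs.const_mul 2)
  refine (hnum.div (hc.pow 2) (pow_ne_zero 2 ht)).congr_deriv ?_
  have hsin : Real.sin t ^ 2 = 1 - Real.cos t ^ 2 := Real.sin_sq t
  simp only [eta, Pi.add_apply, Pi.sub_apply, Pi.mul_apply, Pi.pow_apply, id]
  have hpi := Real.pi_ne_zero
  field_simp
  linear_combination (-4 * Real.cos t ^ 2) * hsin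

theorem hasDerivAt_deriv_eta {t : ℝ} (ht : Real.cos t ≠ 0) :
    HasDerivAt (deriv eta)
      (-2 * Real.sin t / Real.cos t ^ 2 + 2 / Real.cos t ^ 2 * eta t
        + 2 * (Real.sin t / Real.cos t) * deriv eta t) t := by
  have hs := Real.hasDerivAt_sin t
  have hc := Real.hasDerivAt_cos t
  have heta := hasDerivAt_eta ht
  have hsec := (hasDerivAt_const t (2 : ℝ)).div hc ht
  have hformula := (hsec.const_sub (8 / Real.pi)).add
    (((hs.div hc ht).const_mul 2).mul heta)
  have heq : deriv eta =ᶠ[𝓝 t] fun x =>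
      8 / Real.pi - 2 / Real.cos x + 2 * (Real.sin x / Real.cos x) * eta x := by
    filter_upwards [Real.continuous_cos.continuousAt.eventually_ne ht] with x hx
    exact (hasDerivAt_eta hx).deriv
  refine (hformula.congr_of_eventuallyEq heq).congr_deriv ?_
  rw [heta.deriv]
  have hsin : Real.sin t ^ 2 = 1 - Real.cos t ^ 2 := Real.sin_sq t
  simp only [Pi.div_apply]
  have hpi := Real.pi_ne_zero
  field_simp
  linear_combination 2 * Real.pi * eta t * hsin

theorem eta_ode :
    ∀ t ∈ Set.Ioo (-(Real.pi / 2)) (Real.pi / 2),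
      (1 / 2) * deriv (deriv eta) t * Real.cos t ^ 2
        - deriv eta t * Real.cos t * Real.sin t - eta t = -Real.sin t := by
  intro t ht
  have hc : Real.cos t ≠ 0 := (Real.cos_pos_of_mem_Ioo ht).ne'
  rw [(hasDerivAt_deriv_eta hc).deriv]
  field_simp
  ring
end

section
/- For all t in (−π/2, π/2) one has −1 ≤ η(t) ≤ 1; moreover η(t) tends to −1 as t tends to −π/2 from the right and η(t) tends to 1 as t tends to π/2 from the left. -/
open Real Set Filter Topology

theorem eta_neg (t : ℝ) : eta (-t) = -eta t := by
  simp only [eta, Real.cos_neg, Real.sin_neg]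
  ring

/-- The numerator of `eta`. -/
noncomputable def etaNum (t : ℝ) : ℝ :=
  (4 / Real.pi) * t + (4 / Real.pi) * Real.cos t * Real.sin t - 2 * Real.sin t

theorem etaNum_pi_div_two : etaNum (Real.pi / 2) = 0 := by
  have := Real.pi_ne_zero
  simp only [etaNum, Real.cos_pi_div_two, Real.sin_pi_div_two]
  field_simp
  ring

theorem hasDerivAt_etaNum (t : ℝ) :
    HasDerivAt etaNum (2 * Real.cos t * (4 / Real.pi * Real.cos t - 1)) t := by
  have h := (((hasDerivAt_id t).const_mul (4 / Real.pi)).add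
    (((Real.hasDerivAt_cos t).const_mul (4 / Real.pi)).mul (Real.hasDerivAt_sin t))).sub
    ((Real.hasDerivAt_sin t).const_mul 2)
  refine h.congr_deriv ?_
  linear_combination (-(4 / Real.pi)) * Real.sin_sq_add_cos_sq t

theorem hasDerivAt_cos_sq (t : ℝ) :
    HasDerivAt (fun x => Real.cos x ^ 2) (-(2 * Real.cos t * Real.sin t)) t := by
  refine ((Real.hasDerivAt_cos t).pow 2).congr_deriv ?_
  simp

theorem etaNum_nonneg {t : ℝ} (h0 : 0 ≤ t) (h1 : t ≤ Real.pi / 2) : 0 ≤ etaNum t := by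
  have hpi := Real.pi_pos
  rcases le_total 1 (4 / Real.pi * Real.cos t) with hc | hc
  · have hmono : MonotoneOn etaNum (Icc 0 t) := by
      refine monotoneOn_of_hasDerivWithinAt_nonneg (convex_Icc _ _)
        (fun x _ => (hasDerivAt_etaNum x).continuousAt.continuousWithinAt)
        (fun x _ => (hasDerivAt_etaNum x).hasDerivWithinAt) fun x hx => ?_
      rw [interior_Icc] at hx
      have hcos := Real.cos_le_cos_of_nonneg_of_le_pi hx.1.le (by linarith) hx.2.le
      have hle : 4 / Real.pi * Real.cos t ≤ 4 / Real.pi * Real.cos x := by gcongr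
      have hx0 := Real.cos_nonneg_of_mem_Icc (x := x) ⟨by linarith [hx.1], by linarith [hx.2]⟩
      exact mul_nonneg (by positivity) (by linarith)
    simpa [etaNum] using hmono (left_mem_Icc.2 h0) (right_mem_Icc.2 h0) h0
  · have hanti : AntitoneOn etaNum (Icc t (Real.pi / 2)) := by
      refine antitoneOn_of_hasDerivWithinAt_nonpos (convex_Icc _ _)
        (fun x _ => (hasDerivAt_etaNum x).continuousAt.continuousWithinAt)
        (fun x _ => (hasDerivAt_etaNum x).hasDerivWithinAt) fun x hx => ?_
      rw [interior_Icc] at hx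
      have hcos := Real.cos_le_cos_of_nonneg_of_le_pi h0 (by linarith [hx.2]) hx.1.le
      have hle : 4 / Real.pi * Real.cos x ≤ 4 / Real.pi * Real.cos t := by gcongr
      have hx0 := Real.cos_nonneg_of_mem_Icc (x := x) ⟨by linarith [hx.1], by linarith [hx.2]⟩
      exact mul_nonpos_of_nonneg_of_nonpos (by positivity) (by linarith)
    rw [← etaNum_pi_div_two]
    exact hanti (left_mem_Icc.2 h1) (right_mem_Icc.2 h1) h1

theorem etaNum_le_cos_sq {t : ℝ} (h0 : 0 ≤ t) (h1 : t ≤ Real.pi / 2) :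
    etaNum t ≤ Real.cos t ^ 2 := by
  have hd (x : ℝ) := (hasDerivAt_cos_sq x).sub (hasDerivAt_etaNum x)
  have hanti : AntitoneOn ((fun x => Real.cos x ^ 2) - etaNum) (Icc 0 (Real.pi / 2)) := by
    refine antitoneOn_of_hasDerivWithinAt_nonpos (convex_Icc _ _)
      (fun x _ => (hd x).continuousAt.continuousWithinAt)
      (fun x _ => (hd x).hasDerivWithinAt) fun x hx => ?_
    rw [interior_Icc] at hx
    have hc := Real.cos_nonneg_of_mem_Icc (x := x) ⟨by linarith [hx.1], by linarith [hx.2]⟩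
    have hs := Real.sin_nonneg_of_nonneg_of_le_pi hx.1.le (by linarith [hx.1, hx.2])
    have hsum : 1 ≤ Real.sin x + Real.cos x := by
      nlinarith [Real.sin_sq_add_cos_sq x, mul_nonneg hs hc]
    have hpi : 1 ≤ 4 / Real.pi := (one_le_div Real.pi_pos).2 Real.pi_le_four
    have hle : Real.cos x ≤ 4 / Real.pi * Real.cos x := le_mul_of_one_le_left hc hpi
    nlinarith [mul_nonneg hc
      (by linarith : 0 ≤ Real.sin x + 4 / Real.pi * Real.cos x - 1)]
  have h := hanti ⟨h0, h1⟩ (right_mem_Icc.2 (h0.trans h1)) h1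
  simp only [Pi.sub_apply, etaNum_pi_div_two, Real.cos_pi_div_two] at h
  linarith

theorem eta_mem_Icc_of_nonneg {t : ℝ} (h0 : 0 ≤ t) (h1 : t < Real.pi / 2) :
    eta t ∈ Icc 0 1 := by
  have hc := Real.cos_pos_of_mem_Ioo (x := t) ⟨by linarith [Real.pi_pos], h1⟩
  exact ⟨div_nonneg (etaNum_nonneg h0 h1.le) (sq_nonneg _),
    (div_le_one (by positivity)).2 (etaNum_le_cos_sq h0 h1.le)⟩

theorem tendsto_eta_pi_div_two : Tendsto eta (𝓝[<] (Real.pi / 2)) (𝓝 1) := by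
  have hpi := Real.pi_pos
  have hev : ∀ᶠ x in 𝓝[<] (Real.pi / 2), 0 < Real.cos x ∧ 0 < Real.sin x := by
    filter_upwards [Ioo_mem_nhdsLT (by positivity : 0 < Real.pi / 2)] with x hx
    exact ⟨Real.cos_pos_of_mem_Ioo ⟨by linarith [hx.1], hx.2⟩,
      Real.sin_pos_of_pos_of_lt_pi hx.1 (by linarith [hx.2])⟩
  refine HasDerivAt.lhopital_zero_nhdsLT (f := etaNum) (g := fun x => Real.cos x ^ 2)
    (.of_forall hasDerivAt_etaNum) (.of_forall hasDerivAt_cos_sq) ?_ ?_ ?_ ?_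
  · filter_upwards [hev] with x ⟨hc, hs⟩
    exact neg_ne_zero.2 (by positivity)
  · have h := (hasDerivAt_etaNum (Real.pi / 2)).continuousAt.tendsto
    rw [etaNum_pi_div_two] at h
    exact h.mono_left nhdsWithin_le_nhds
  · have h := (hasDerivAt_cos_sq (Real.pi / 2)).continuousAt.tendsto
    rw [Real.cos_pi_div_two, zero_pow two_ne_zero] at h
    exact h.mono_left nhdsWithin_le_nhds
  · have h : ContinuousAt (fun x => (1 - 4 / Real.pi * Real.cos x) / Real.sin x) (Real.pi / 2) :=
      ContinuousAt.div (by fun_prop) (by fun_prop) (by simp)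
    have h' := h.tendsto.mono_left (nhdsWithin_le_nhds (s := Iio (Real.pi / 2)))
    simp only [Real.cos_pi_div_two, Real.sin_pi_div_two, mul_zero, sub_zero, div_one] at h'
    refine h'.congr' ?_
    filter_upwards [hev] with x ⟨hc, hs⟩
    field_simp
    ring

theorem eta_bounds :
    (∀ t ∈ Set.Ioo (-(Real.pi / 2)) (Real.pi / 2), -1 ≤ eta t ∧ eta t ≤ 1) ∧
    Filter.Tendsto eta (nhdsWithin (-(Real.pi / 2)) (Set.Ioi (-(Real.pi / 2)))) (nhds (-1)) ∧
    Filter.Tendsto eta (nhdsWithin (Real.pi / 2) (Set.Iio (Real.pi / 2))) (nhds 1) := by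
  refine ⟨fun t ht => ?_, ?_, tendsto_eta_pi_div_two⟩
  · rcases le_total 0 t with h | h
    · have := eta_mem_Icc_of_nonneg h ht.2
      exact ⟨by linarith [this.1], this.2⟩
    · have := eta_mem_Icc_of_nonneg (neg_nonneg.2 h) (by linarith [ht.1])
      rw [eta_neg] at this
      exact ⟨by linarith [this.2], by linarith [this.1]⟩
  · have hneg : Tendsto Neg.neg (𝓝[>] (-(Real.pi / 2))) (𝓝[<] (Real.pi / 2)) := by
      simpa using tendsto_neg_nhdsGT (a := -(Real.pi / 2))
    refine (tendsto_eta_pi_div_two.comp hneg).neg.congr fun t => ?_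
    simp [eta_neg]
end

section
/- The function r(t) = ξ'(t)/η'(t) is strictly increasing on (−π/2, π/2) (i.e., r'(t) > 0 there), satisfies |r(t)| ≤ π²/4 for all t in (−π/2, π/2), and r(t) tends to π²/4 as t tends to π/2 from the left and to −π²/4 as t tends to −π/2 from the right. -/
open Real Set Filter Topology

/-- The Taylor remainders of `cos` and `sin` at `0` have alternating signs on `[0, ∞)`. -/
theorem taylor_remainder_cos_sin_alternating (n : ℕ) :
    (∀ x : ℝ, 0 ≤ x → 0 ≤ (-1) ^ (n + 1) *
      (cos x - ∑ k ∈ Finset.range (n + 1), (-1) ^ k * x ^ (2 * k) / (2 * k).factorial)) ∧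
    (∀ x : ℝ, 0 ≤ x → 0 ≤ (-1) ^ (n + 1) *
      (sin x - ∑ k ∈ Finset.range (n + 1), (-1) ^ k * x ^ (2 * k + 1) / (2 * k + 1).factorial)) :=
        by
  have sin_of_cos (n : ℕ) (h : ∀ x : ℝ, 0 ≤ x → 0 ≤ (-1) ^ (n + 1) *
      (cos x - ∑ k ∈ Finset.range (n + 1), (-1) ^ k * x ^ (2 * k) / (2 * k).factorial)) (x : ℝ)
      (hx : 0 ≤ x) : 0 ≤ (-1) ^ (n + 1) *
      (sin x - ∑ k ∈ Finset.range (n + 1),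
        (-1) ^ k * x ^ (2 * k + 1) / (2 * k + 1).factorial) := by
    have hd (y : ℝ) : HasDerivAt (fun y => (-1) ^ (n + 1) *
        (sin y - ∑ k ∈ Finset.range (n + 1), (-1) ^ k * y ^ (2 * k + 1) / (2 * k + 1).factorial))
        ((-1) ^ (n + 1) * (cos y -
          ∑ k ∈ Finset.range (n + 1), (-1) ^ k * y ^ (2 * k) / (2 * k).factorial)) y := by
      refine ((hasDerivAt_sin y).sub (HasDerivAt.fun_sum fun k _ => ?_)).const_mul _
      refine (((hasDerivAt_pow (2 * k + 1) y).const_mul ((-1) ^ k)).div_const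
        ((2 * k + 1).factorial : ℝ)).congr_deriv ?_
      rw [Nat.factorial_succ]
      push_cast
      field_simp
    have hmono := monotoneOn_of_hasDerivWithinAt_nonneg (convex_Ici (0 : ℝ))
      (fun y _ => (hd y).continuousAt.continuousWithinAt)
      (fun y _ => (hd y).hasDerivWithinAt) (fun y hy => h y (interior_subset hy))
    simpa using hmono (mem_Ici.2 le_rfl) (mem_Ici.2 hx) hx
  suffices h : ∀ x : ℝ, 0 ≤ x → 0 ≤ (-1) ^ (n + 1) *
      (cos x - ∑ k ∈ Finset.range (n + 1), (-1) ^ k * x ^ (2 * k) / (2 * k).factorial) from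
    ⟨h, sin_of_cos n h⟩
  induction n with
  | zero => intro x _; simp [cos_le_one]
  | succ n ih =>
    intro x hx
    have hs := sin_of_cos n ih
    have hd (y : ℝ) : HasDerivAt (fun y => (-1) ^ (n + 1 + 1) *
        (cos y - ∑ k ∈ Finset.range (n + 1 + 1), (-1) ^ k * y ^ (2 * k) / (2 * k).factorial))
        ((-1) ^ (n + 1) * (sin y -
          ∑ k ∈ Finset.range (n + 1), (-1) ^ k * y ^ (2 * k + 1) / (2 * k + 1).factorial)) y := by
      simp_rw [Finset.sum_range_succ' _ (n + 1)]
      have hsum : HasDerivAt (fun y : ℝ => ∑ k ∈ Finset.range (n + 1),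
          (-1) ^ (k + 1) * y ^ (2 * (k + 1)) / (2 * (k + 1)).factorial)
          (∑ k ∈ Finset.range (n + 1),
            -((-1) ^ k * y ^ (2 * k + 1) / (2 * k + 1).factorial)) y := by
        refine HasDerivAt.fun_sum fun k _ => ?_
        refine (((hasDerivAt_pow (2 * (k + 1)) y).const_mul ((-1) ^ (k + 1))).div_const
          ((2 * (k + 1)).factorial : ℝ)).congr_deriv ?_
        rw [show 2 * (k + 1) = 2 * k + 1 + 1 by ring, Nat.factorial_succ (2 * k + 1)]
        push_cast
        field_simp
        simp only [pow_succ]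
        ring
      refine (((hasDerivAt_cos y).fun_sub
        (hsum.add_const ((-1) ^ 0 * y ^ 0 / (Nat.factorial 0 : ℝ)))).const_mul
          ((-1) ^ (n + 1 + 1))).congr_deriv ?_
      rw [Finset.sum_neg_distrib]
      ring
    have hmono := monotoneOn_of_hasDerivWithinAt_nonneg (convex_Ici (0 : ℝ))
      (fun y _ => (hd y).continuousAt.continuousWithinAt)
      (fun y _ => (hd y).hasDerivWithinAt) (fun y hy => hs y (interior_subset hy))
    have := hmono (mem_Ici.2 le_rfl) (mem_Ici.2 hx) hx
    simp_rw [Finset.sum_range_succ' _ (n + 1)] at this ⊢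
    simpa using this

/-- Positivity of the Taylor lower bound, in `w = u²`, for the part of the numerator linear in `π`. -/
theorem taylor_poly_linear_coeff_pos {w : ℝ} (hw : 0 < w) (hw' : w ≤ 24675 / 10000) :
    0 < 2 / 3 - 11 / 45 * w + 731 / 20160 * w ^ 2 - 1 / 315 * w ^ 3 + 1 / 5400 * w ^ 4
      - 11 / 1451520 * w ^ 5 + 1787 / 8128512000 * w ^ 6 - 43 / 9754214400 * w ^ 7
      + 11 / 195084288000 * w ^ 8 - 1 / 2731180032000 * w ^ 9 := by
  have hw1 : 0 ≤ 5 / 2 - w := by linarith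
  have hcubic : 0 < 6666 / 10000 - 2445 / 10000 * w + 3625 / 100000 * w ^ 2
      - 3175 / 1000000 * w ^ 3 := by
    obtain ⟨z, rfl⟩ : ∃ z, w = 24675 / 10000 - z := ⟨24675 / 10000 - w, by ring⟩
    have hz : 0 ≤ z := by linarith
    nlinarith [pow_nonneg hz 2, pow_nonneg hz 3]
  linarith [mul_nonneg (pow_nonneg hw.le 4) hw1, mul_nonneg (pow_nonneg hw.le 6) hw1,
    mul_nonneg (pow_nonneg hw.le 8) hw1, pow_pos hw 2, pow_pos hw 3, pow_pos hw 4, pow_pos hw 6,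
    pow_pos hw 8]

/-- Positivity of the Taylor lower bound, in `w = u²`, for the whole numerator. -/
theorem taylor_poly_numerator_pos {w : ℝ} (hw : 0 < w) (hw' : w ≤ 24675 / 10000) :
    0 < 613 / 400 - 3813 / 1600 * w + 15671 / 9600 * w ^ 2 - 107473003 / 189312000 * w ^ 3
      + 1285322083 / 11926656000 * w ^ 4 - 295927 / 24116400 * w ^ 5 + 3817 / 4141200 * w ^ 6
      - 7781 / 159022080 * w ^ 7 + 14962973 / 8014712832000 * w ^ 8
      - 164159 / 3205885132800 * w ^ 9 + 188269 / 192353107968000 * w ^ 10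
      - 32279 / 2692943511552000 * w ^ 11 := by
  have hw1 : 0 ≤ 5 / 2 - w := by linarith
  have hseptic : 0 < 15325 / 10000 - 23832 / 10000 * w + 16323 / 10000 * w ^ 2
      - 5678 / 10000 * w ^ 3 + 10776 / 100000 * w ^ 4 - 12271 / 1000000 * w ^ 5
      + 921 / 1000000 * w ^ 6 - 49 / 1000000 * w ^ 7 := by
    obtain ⟨z, rfl⟩ : ∃ z, w = 24675 / 10000 - z := ⟨24675 / 10000 - w, by ring⟩
    have hz : 0 ≤ z := by linarith
    linarith [pow_nonneg hz 2, pow_nonneg hz 3, pow_nonneg hz 4, pow_nonneg hz 5,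
      pow_nonneg hz 6, pow_nonneg hz 7, mul_nonneg hz (sq_nonneg (z - 8 / 10))]
  linarith [mul_nonneg (pow_nonneg hw.le 8) hw1, mul_nonneg (pow_nonneg hw.le 10) hw1,
    pow_pos hw 2, pow_pos hw 3, pow_pos hw 4, pow_pos hw 5, pow_pos hw 6, pow_pos hw 7,
    pow_pos hw 8, pow_pos hw 10]

/-- The numerator of the derivative of `u ↦ (2au - u² - 3 sin² u) / (2 (u - a (1 - cos u)))`, up to
sign, is positive when `a` is close to `π / 2` and `S`, `C` obey the Taylor bounds of `sin u`,
`cos u`. -/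
theorem numerator_pos_of_taylor_bounds {u a S C : ℝ} (hu : 0 < u) (hua : u ≤ a)
    (ha : 157 / 100 + 1 / 2000 < a) (ha' : a < 15708 / 10000)
    (hsq : 1 - 2 * S ^ 2 ≥ 1 - 2 * u ^ 2 + 2 / 3 * u ^ 4 - 4 / 45 * u ^ 6 + 2 / 315 * u ^ 8
      - 4 / 14175 * u ^ 10)
    (hmul : 2 * S * C ≥ 2 * u - 4 / 3 * u ^ 3 + 4 / 15 * u ^ 5 - 8 / 315 * u ^ 7
      + 4 / 2835 * u ^ 9 - 8 / 155925 * u ^ 11)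
    (hCle : C ≤ 1 - u ^ 2 / 2 + u ^ 4 / 24 - u ^ 6 / 720 + u ^ 8 / 40320)
    (hSle : S ≤ u - u ^ 3 / 6 + u ^ 5 / 120 - u ^ 7 / 5040 + u ^ 9 / 362880)
    (hleC : 1 - u ^ 2 / 2 + u ^ 4 / 24 - u ^ 6 / 720 ≤ C)
    (hleS : u - u ^ 3 / 6 + u ^ 5 / 120 - u ^ 7 / 5040 ≤ S) :
    0 < u ^ 2 - 3 * S ^ 2 + 6 * u * (S * C) - 2 * a ^ 2 * (u * S - (1 - C))
      + a * (u ^ 2 * S - 2 * u * (1 - C) + 3 * S * (1 - C) ^ 2) := by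
  obtain ⟨z, hz⟩ : ∃ z, u ^ 2 = 24675 / 10000 - z := ⟨24675 / 10000 - u ^ 2, by ring⟩
  have ha2 : a ^ 2 ≤ 24675 / 10000 := by nlinarith
  have hu2 : u ^ 2 ≤ 24675 / 10000 := by nlinarith
  have hz0 : 0 ≤ z := by linarith
  have hz1 : 0 ≤ 24675 / 10000 - z := by linarith [sq_nonneg u]
  have hSlo0 : 0 ≤ u - u ^ 3 / 6 + u ^ 5 / 120 - u ^ 7 / 5040 := by
    have : 0 < 1 - u ^ 2 / 6 + (u ^ 2) ^ 2 / 120 - (u ^ 2) ^ 3 / 5040 := by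
      rw [hz]; nlinarith [pow_nonneg hz0 2, pow_nonneg hz0 3]
    linarith [mul_pos hu this]
  have hVlo0 : 0 ≤ u ^ 2 / 2 - u ^ 4 / 24 + u ^ 6 / 720 - u ^ 8 / 40320 := by
    have : 0 < 1 / 2 - u ^ 2 / 24 + (u ^ 2) ^ 2 / 720 - (u ^ 2) ^ 3 / 40320 := by
      rw [hz]; nlinarith [pow_nonneg hz0 2, pow_nonneg hz0 3]
    linarith [mul_pos (pow_pos hu 2) this]
  have hXhi0 : 0 ≤ u ^ 2 / 2 - u ^ 4 / 8 + u ^ 6 / 144 - u ^ 8 / 5760 + u ^ 10 / 362880 := by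
    have : 0 < 1 / 2 - u ^ 2 / 8 + (u ^ 2) ^ 2 / 144 - (u ^ 2) ^ 3 / 5760
        + (u ^ 2) ^ 4 / 362880 := by
      rw [hz]; nlinarith [pow_nonneg hz0 2, pow_nonneg hz0 3, pow_nonneg hz0 4]
    linarith [mul_pos (pow_pos hu 2) this]
  have hX : a ^ 2 * (u * S - (1 - C)) ≤ 24675 / 10000 *
      (u ^ 2 / 2 - u ^ 4 / 8 + u ^ 6 / 144 - u ^ 8 / 5760 + u ^ 10 / 362880) := by
    have : u * S - (1 - C) ≤
        u ^ 2 / 2 - u ^ 4 / 8 + u ^ 6 / 144 - u ^ 8 / 5760 + u ^ 10 / 362880 := by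
      linarith [mul_le_mul_of_nonneg_left hSle hu.le]
    exact (mul_le_mul_of_nonneg_left this (sq_nonneg a)).trans
      (mul_le_mul_of_nonneg_right ha2 hXhi0)
  have hcube : (u - u ^ 3 / 6 + u ^ 5 / 120 - u ^ 7 / 5040) *
      (u ^ 2 / 2 - u ^ 4 / 24 + u ^ 6 / 720 - u ^ 8 / 40320) ^ 2 ≤ S * (1 - C) ^ 2 :=
    mul_le_mul hleS (pow_le_pow_left₀ hVlo0 (by linarith) 2) (sq_nonneg _) (hSlo0.trans hleS)
  have hB : u ^ 5 * (2 / 3 - 11 / 45 * u ^ 2 + 731 / 20160 * (u ^ 2) ^ 2 - 1 / 315 * (u ^ 2) ^ 3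
      + 1 / 5400 * (u ^ 2) ^ 4
      - 11 / 1451520 * (u ^ 2) ^ 5 + 1787 / 8128512000 * (u ^ 2) ^ 6
      - 43 / 9754214400 * (u ^ 2) ^ 7 + 11 / 195084288000 * (u ^ 2) ^ 8
      - 1 / 2731180032000 * (u ^ 2) ^ 9) ≤
      u ^ 2 * S - 2 * u * (1 - C) + 3 * S * (1 - C) ^ 2 := by
    linarith [mul_le_mul_of_nonneg_left hleS (sq_nonneg u), mul_le_mul_of_nonneg_left hleC hu.le]
  have hf : u * (3 / 2 - 100 / 493 * u ^ 2) ≤ a := by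
    nlinarith [mul_nonneg hu.le (sq_nonneg (u - 157 / 100)), sq_nonneg (u - 157 / 100)]
  have hfB := mul_le_mul hf hB (mul_nonneg (pow_nonneg hu.le 5)
    (taylor_poly_linear_coeff_pos (pow_pos hu 2) hu2).le) (hu.le.trans hua)
  linarith [mul_pos (pow_pos hu 2) (taylor_poly_numerator_pos (pow_pos hu 2) hu2),
    mul_le_mul_of_nonneg_left hmul hu.le, pow_pos hu 26]

theorem derivNumRatio_deriv_numerator_pos {u : ℝ} (hu : 0 < u) (hua : u ≤ π / 2) :
    0 < u ^ 2 - 3 * sin u ^ 2 + 6 * u * (sin u * cos u)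
      - 2 * (π / 2) ^ 2 * (u * sin u - (1 - cos u))
      + π / 2 * (u ^ 2 * sin u - 2 * u * (1 - cos u) + 3 * sin u * (1 - cos u) ^ 2) := by
  have hcos_dbl := (taylor_remainder_cos_sin_alternating 5).1 (2 * u) (by linarith)
  have hsin_dbl := (taylor_remainder_cos_sin_alternating 5).2 (2 * u) (by linarith)
  have hcos_le := (taylor_remainder_cos_sin_alternating 4).1 u hu.le
  have hsin_le := (taylor_remainder_cos_sin_alternating 4).2 u hu.le
  have hle_cos := (taylor_remainder_cos_sin_alternating 3).1 u hu.le
  have hle_sin := (taylor_remainder_cos_sin_alternating 3).2 u hu.le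
  rw [cos_two_mul, cos_sq'] at hcos_dbl
  rw [sin_two_mul] at hsin_dbl
  simp only [Finset.sum_range_succ, Finset.sum_range_zero, Nat.factorial] at *
  norm_num at hcos_dbl hsin_dbl hcos_le hsin_le hle_cos hle_sin
  apply numerator_pos_of_taylor_bounds hu hua <;> linarith [pi_lt_d4, pi_gt_d4]

/-- Half the derivative of `xi` multiplied by `cos³`. -/
noncomputable def xiDerivNum (t : ℝ) : ℝ :=
  sin t * cos t ^ 2 + 2 * t * cos t + (t ^ 2 - (π / 2) ^ 2) * sin t

/-- The derivative of `eta` multiplied by `(π / 4) cos³`. -/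
noncomputable def etaDerivNum (t : ℝ) : ℝ :=
  2 * cos t + 2 * t * sin t - π / 2 * (1 + sin t ^ 2)

/-- The ratio of the derivatives of `xiDerivNum` and `etaDerivNum`. -/
noncomputable def derivNumRatio (t : ℝ) : ℝ :=
  ((π / 2) ^ 2 - t ^ 2 - 3 * cos t ^ 2) / (2 * (π / 2 * sin t - t))

theorem hasDerivAt_xiDerivNum (t : ℝ) :
    HasDerivAt xiDerivNum (cos t * (3 * cos t ^ 2 + t ^ 2 - (π / 2) ^ 2)) t := by
  refine ((((hasDerivAt_sin t).mul ((hasDerivAt_cos t).pow 2)).add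
    (((hasDerivAt_id t).const_mul 2).mul (hasDerivAt_cos t))).add
    ((((hasDerivAt_id t).pow 2).sub_const _).mul (hasDerivAt_sin t))).congr_deriv ?_
  simp
  linear_combination (-2 * cos t) * sin_sq_add_cos_sq t

theorem hasDerivAt_etaDerivNum (t : ℝ) :
    HasDerivAt etaDerivNum (2 * cos t * (t - π / 2 * sin t)) t := by
  refine ((((hasDerivAt_cos t).const_mul 2).add
    (((hasDerivAt_id t).const_mul 2).mul (hasDerivAt_sin t))).sub
    ((((hasDerivAt_sin t).pow 2).const_add 1).const_mul (π / 2))).congr_deriv ?_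
  simp
  ring

theorem deriv_xi_eq {t : ℝ} (ht : cos t ≠ 0) : deriv xi t = 2 * xiDerivNum t / cos t ^ 3 := by
  refine HasDerivAt.deriv ((((((hasDerivAt_cos t).pow 2).add
    ((((hasDerivAt_id t).const_mul 2).mul (hasDerivAt_sin t)).mul (hasDerivAt_cos t))).add
    ((hasDerivAt_id t).pow 2)).sub_const (π ^ 2 / 4)).div ((hasDerivAt_cos t).pow 2)
    (pow_ne_zero 2 ht) |>.congr_deriv ?_)
  simp [xiDerivNum]
  field_simp
  linear_combination 16 * cos t * t * sin_sq_add_cos_sq t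

theorem deriv_eta_eq {t : ℝ} (ht : cos t ≠ 0) :
    deriv eta t = 4 / π * etaDerivNum t / cos t ^ 3 := by
  refine HasDerivAt.deriv (((((hasDerivAt_id t).const_mul (4 / π)).add
    (((hasDerivAt_cos t).const_mul (4 / π)).mul (hasDerivAt_sin t))).sub
    ((hasDerivAt_sin t).const_mul 2)).div ((hasDerivAt_cos t).pow 2)
    (pow_ne_zero 2 ht) |>.congr_deriv ?_)
  simp [etaDerivNum]
  field_simp
  linear_combination (8 * cos t - 4 * π) * sin_sq_add_cos_sq t

theorem deriv_xi_div_deriv_eta_eq {t : ℝ} (ht : t ∈ Ioo (-(π / 2)) (π / 2)) :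
    deriv xi t / deriv eta t = π / 2 * (xiDerivNum t / etaDerivNum t) := by
  have hc := (cos_pos_of_mem_Ioo ht).ne'
  rw [deriv_xi_eq hc, deriv_eta_eq hc, div_div_div_cancel_right₀ (pow_ne_zero 3 hc)]
  field_simp
  ring

theorem pi_div_two_mul_sin_sub_pos {t : ℝ} (ht : t ∈ Ioo 0 (π / 2)) : 0 < π / 2 * sin t - t := by
  have h := mul_lt_sin ht.1 ht.2
  have : π / 2 * (2 / π * t) = t := by field_simp
  linarith [mul_lt_mul_of_pos_left h pi_div_two_pos]

theorem strictMonoOn_derivNumRatio : StrictMonoOn derivNumRatio (Ioo 0 (π / 2)) := by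
  have hd : ∀ t ∈ Ioo 0 (π / 2), HasDerivAt derivNumRatio
      (((-(2 * t) + 6 * cos t * sin t) * (2 * (π / 2 * sin t - t)) -
        ((π / 2) ^ 2 - t ^ 2 - 3 * cos t ^ 2) * (2 * (π / 2 * cos t - 1))) /
          (2 * (π / 2 * sin t - t)) ^ 2) t := by
    intro t ht
    refine (((((hasDerivAt_id t).pow 2).const_sub ((π / 2) ^ 2)).sub
      (((hasDerivAt_cos t).pow 2).const_mul 3)).div
      ((((hasDerivAt_sin t).const_mul (π / 2)).sub (hasDerivAt_id t)).const_mul 2)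
      (by simpa using (pi_div_two_mul_sin_sub_pos ht).ne')).congr_deriv ?_
    simp
    ring
  refine strictMonoOn_of_hasDerivWithinAt_pos (convex_Ioo _ _)
    (fun t ht => (hd t ht).continuousAt.continuousWithinAt)
    (fun t ht => (hd t (interior_subset ht)).hasDerivWithinAt) fun t ht => ?_
  rw [interior_Ioo] at ht
  refine div_pos ?_ (pow_pos (mul_pos two_pos (pi_div_two_mul_sin_sub_pos ht)) 2)
  have h := derivNumRatio_deriv_numerator_pos (u := π / 2 - t) (by linarith [ht.2]) (by linarith [ht.1])
  rw [sin_pi_div_two_sub, cos_pi_div_two_sub] at h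
  linear_combination 2 * h - 6 * (π / 2) * cos t * sin_sq_add_cos_sq t

theorem xiDerivNum_neg (t : ℝ) : xiDerivNum (-t) = -xiDerivNum t := by
  simp [xiDerivNum]; ring

theorem etaDerivNum_neg (t : ℝ) : etaDerivNum (-t) = etaDerivNum t := by
  simp [etaDerivNum]

theorem xiDerivNum_pi_div_two : xiDerivNum (π / 2) = 0 := by simp [xiDerivNum]

theorem etaDerivNum_pi_div_two : etaDerivNum (π / 2) = 0 := by simp [etaDerivNum]; ring

theorem etaDerivNum_pos {t : ℝ} (ht : t ∈ Ioo (-(π / 2)) (π / 2)) : 0 < etaDerivNum t := by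
  wlog h : 0 ≤ t generalizing t
  · rw [← etaDerivNum_neg]
    exact this ⟨by linarith [ht.2], by linarith [ht.1]⟩ (by linarith)
  have hanti : StrictAntiOn etaDerivNum (Icc 0 (π / 2)) := by
    refine strictAntiOn_of_hasDerivWithinAt_neg (convex_Icc _ _)
      (fun x _ => (hasDerivAt_etaDerivNum x).continuousAt.continuousWithinAt)
      (fun x _ => (hasDerivAt_etaDerivNum x).hasDerivWithinAt) fun x hx => ?_
    rw [interior_Icc] at hx
    have := cos_pos_of_mem_Ioo ⟨by linarith [hx.1, pi_pos], hx.2⟩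
    exact mul_neg_of_pos_of_neg (by linarith) (by linarith [pi_div_two_mul_sin_sub_pos hx])
  rw [← etaDerivNum_pi_div_two]
  exact hanti ⟨h, ht.2.le⟩ (right_mem_Icc.2 pi_div_two_pos.le) ht.2

/-- The monotone form of l'Hôpital's rule applied to `xiDerivNum / etaDerivNum` at `π / 2`. -/
theorem derivNumRatio_mul_etaDerivNum_lt {t : ℝ} (ht : t ∈ Ioo 0 (π / 2)) :
    derivNumRatio t * etaDerivNum t < xiDerivNum t := by
  have hd (x : ℝ) := (hasDerivAt_xiDerivNum x).sub
    ((hasDerivAt_etaDerivNum x).const_mul (derivNumRatio t))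
  have hanti := strictAntiOn_of_hasDerivWithinAt_neg (convex_Icc t (π / 2))
    (fun x _ => (hd x).continuousAt.continuousWithinAt)
    (fun x _ => (hd x).hasDerivWithinAt) fun x hx => by
      rw [interior_Icc] at hx
      have hx' : x ∈ Ioo 0 (π / 2) := ⟨ht.1.trans hx.1, hx.2⟩
      have hG := pi_div_two_mul_sin_sub_pos hx'
      have hc := cos_pos_of_mem_Ioo ⟨by linarith [hx'.1, pi_pos], hx.2⟩
      have hK := strictMonoOn_derivNumRatio ht hx' hx.1
      have hKx : derivNumRatio x * (2 * (π / 2 * sin x - x)) =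
          (π / 2) ^ 2 - x ^ 2 - 3 * cos x ^ 2 := div_mul_cancel₀ _ (by linarith)
      have := mul_pos (mul_pos hc hG) (sub_pos.2 hK)
      linear_combination 2 * this + cos x * hKx
  have := hanti (left_mem_Icc.2 ht.2.le) (right_mem_Icc.2 ht.2.le) ht.2
  simp [xiDerivNum_pi_div_two, etaDerivNum_pi_div_two] at this
  linarith

theorem wronskian_pos {t : ℝ} (ht : t ∈ Ioo (-(π / 2)) (π / 2)) :
    0 < cos t * (3 * cos t ^ 2 + t ^ 2 - (π / 2) ^ 2) * etaDerivNum t -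
      xiDerivNum t * (2 * cos t * (t - π / 2 * sin t)) := by
  wlog h : 0 ≤ t generalizing t
  · have := this (t := -t) ⟨by linarith [ht.2], by linarith [ht.1]⟩ (by linarith)
    rw [xiDerivNum_neg, etaDerivNum_neg, sin_neg, cos_neg] at this
    linarith
  obtain rfl | h := h.eq_or_lt
  · have h3 : (π / 2) ^ 2 < 3 := by nlinarith [pi_lt_d4, pi_pos]
    simp [xiDerivNum, etaDerivNum]
    nlinarith [pi_lt_d4, pi_pos]
  have ht' : t ∈ Ioo 0 (π / 2) := ⟨h, ht.2⟩
  have hG := pi_div_two_mul_sin_sub_pos ht'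
  have hK : derivNumRatio t * (2 * (π / 2 * sin t - t)) =
      (π / 2) ^ 2 - t ^ 2 - 3 * cos t ^ 2 := div_mul_cancel₀ _ (by linarith)
  have := mul_pos (mul_pos (cos_pos_of_mem_Ioo ht) hG)
    (sub_pos.2 (derivNumRatio_mul_etaDerivNum_lt ht'))
  linear_combination 2 * this - cos t * etaDerivNum t * hK

theorem tendsto_derivNumRatio :
    Tendsto derivNumRatio (𝓝[<] (π / 2)) (𝓝 (π / 2)) := by
  have hlim : Tendsto (fun t => (-(2 * t) + 6 * cos t * sin t) / (2 * (π / 2 * cos t - 1)))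
      (𝓝[<] (π / 2)) (𝓝 (π / 2)) := by
    have : ContinuousAt (fun t => (-(2 * t) + 6 * cos t * sin t) / (2 * (π / 2 * cos t - 1)))
        (π / 2) := ContinuousAt.div (by fun_prop) (by fun_prop) (by simp)
    convert this.tendsto.mono_left nhdsWithin_le_nhds using 2
    simp
  have hnum (t : ℝ) : HasDerivAt (fun t => (π / 2) ^ 2 - t ^ 2 - 3 * cos t ^ 2)
      (-(2 * t) + 6 * cos t * sin t) t := by
    refine ((((hasDerivAt_id t).fun_pow 2).const_sub ((π / 2) ^ 2)).fun_sub
      (((hasDerivAt_cos t).fun_pow 2).const_mul 3)).congr_deriv ?_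
    simp
    ring
  have hden (t : ℝ) : HasDerivAt (fun t => 2 * (π / 2 * sin t - t)) (2 * (π / 2 * cos t - 1)) t :=
    (((hasDerivAt_sin t).const_mul (π / 2)).fun_sub (hasDerivAt_id t)).const_mul 2
  refine HasDerivAt.lhopital_zero_nhdsLT (Eventually.of_forall hnum) (Eventually.of_forall hden)
    (nhdsWithin_le_nhds (ContinuousAt.eventually_ne (by fun_prop) (by simp))) ?_ ?_ hlim
  · simpa using (hnum (π / 2)).continuousAt.tendsto.mono_left nhdsWithin_le_nhds
  · simpa using (hden (π / 2)).continuousAt.tendsto.mono_left nhdsWithin_le_nhds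

theorem tendsto_xiDerivNum_div_etaDerivNum :
    Tendsto (fun t => xiDerivNum t / etaDerivNum t) (𝓝[<] (π / 2)) (𝓝 (π / 2)) := by
  have hIoo : ∀ᶠ t in 𝓝[<] (π / 2), 0 < cos t ∧ 0 < π / 2 * sin t - t := by
    filter_upwards [Ioo_mem_nhdsLT pi_div_two_pos] with t ht
    exact ⟨cos_pos_of_mem_Ioo ⟨by linarith [ht.1, pi_pos], ht.2⟩, pi_div_two_mul_sin_sub_pos ht⟩
  refine HasDerivAt.lhopital_zero_nhdsLT (Eventually.of_forall hasDerivAt_xiDerivNum)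
    (Eventually.of_forall hasDerivAt_etaDerivNum) ?_ ?_ ?_ ?_
  · filter_upwards [hIoo] with t ⟨hc, hG⟩
    exact mul_ne_zero (by linarith) (by linarith)
  · simpa [xiDerivNum_pi_div_two] using
      (hasDerivAt_xiDerivNum (π / 2)).continuousAt.tendsto.mono_left nhdsWithin_le_nhds
  · simpa [etaDerivNum_pi_div_two] using
      (hasDerivAt_etaDerivNum (π / 2)).continuousAt.tendsto.mono_left nhdsWithin_le_nhds
  · refine tendsto_derivNumRatio.congr' ?_
    filter_upwards [hIoo] with t ⟨hc, hG⟩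
    have hG' : t - π / 2 * sin t ≠ 0 := by linarith
    rw [derivNumRatio, div_eq_div_iff (by linarith) (mul_ne_zero (by linarith) hG')]
    ring

theorem r_monotone :
    (∀ t ∈ Set.Ioo (-(Real.pi / 2)) (Real.pi / 2),
      0 < deriv (fun s => deriv xi s / deriv eta s) t) ∧
    StrictMonoOn (fun s => deriv xi s / deriv eta s)
      (Set.Ioo (-(Real.pi / 2)) (Real.pi / 2)) ∧
    (∀ t ∈ Set.Ioo (-(Real.pi / 2)) (Real.pi / 2),
      |deriv xi t / deriv eta t| ≤ Real.pi ^ 2 / 4) ∧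
    Filter.Tendsto (fun s => deriv xi s / deriv eta s)
      (nhdsWithin (Real.pi / 2) (Set.Iio (Real.pi / 2))) (nhds (Real.pi ^ 2 / 4)) ∧
    Filter.Tendsto (fun s => deriv xi s / deriv eta s)
      (nhdsWithin (-(Real.pi / 2)) (Set.Ioi (-(Real.pi / 2)))) (nhds (-(Real.pi ^ 2 / 4))) := by
  have hderiv : ∀ t ∈ Ioo (-(π / 2)) (π / 2),
      ∃ d > 0, HasDerivAt (fun s => deriv xi s / deriv eta s) d t := by
    intro t ht
    refine ⟨_, ?_, (((hasDerivAt_xiDerivNum t).fun_div (hasDerivAt_etaDerivNum t)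
      (etaDerivNum_pos ht).ne').const_mul (π / 2)).congr_of_eventuallyEq ?_⟩
    · exact mul_pos pi_div_two_pos (div_pos (wronskian_pos ht) (pow_pos (etaDerivNum_pos ht) 2))
    · filter_upwards [Ioo_mem_nhds ht.1 ht.2] with s hs using deriv_xi_div_deriv_eta_eq hs
  have hpos : ∀ t ∈ Ioo (-(π / 2)) (π / 2),
      0 < deriv (fun s => deriv xi s / deriv eta s) t := by
    intro t ht
    obtain ⟨d, hd, h⟩ := hderiv t ht
    rwa [h.deriv]
  have hmono : StrictMonoOn (fun s => deriv xi s / deriv eta s) (Ioo (-(π / 2)) (π / 2)) := by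
    refine strictMonoOn_of_deriv_pos (convex_Ioo _ _) (fun t ht => ?_)
      fun t ht => hpos t (interior_subset ht)
    obtain ⟨d, -, h⟩ := hderiv t ht
    exact h.continuousAt.continuousWithinAt
  have hneg : ∀ t ∈ Ioo (-(π / 2)) (π / 2),
      deriv xi (-t) / deriv eta (-t) = -(deriv xi t / deriv eta t) := by
    intro t ht
    rw [deriv_xi_div_deriv_eta_eq ht,
      deriv_xi_div_deriv_eta_eq ⟨neg_lt_neg ht.2, neg_lt.2 ht.1⟩, xiDerivNum_neg, etaDerivNum_neg]
    ring
  have hnear : ∀ᶠ t in 𝓝[<] (π / 2), t ∈ Ioo (-(π / 2)) (π / 2) :=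
    Ioo_mem_nhdsLT (by linarith [pi_pos])
  have hright : Tendsto (fun s => deriv xi s / deriv eta s) (𝓝[<] (π / 2)) (𝓝 (π ^ 2 / 4)) := by
    have := tendsto_xiDerivNum_div_etaDerivNum.const_mul (π / 2)
    rw [show π / 2 * (π / 2) = π ^ 2 / 4 by ring] at this
    refine this.congr' ?_
    filter_upwards [hnear] with t ht using (deriv_xi_div_deriv_eta_eq ht).symm
  have hle : ∀ t ∈ Ioo (-(π / 2)) (π / 2), deriv xi t / deriv eta t ≤ π ^ 2 / 4 := by
    intro t ht
    refine ge_of_tendsto hright ?_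
    filter_upwards [Ioo_mem_nhdsLT ht.2] with s hs
    exact (hmono ht ⟨ht.1.trans hs.1, hs.2⟩ hs.1).le
  refine ⟨hpos, hmono, fun t ht => abs_le.2 ⟨?_, hle t ht⟩, hright, ?_⟩
  · have := hle (-t) ⟨neg_lt_neg ht.2, neg_lt.2 ht.1⟩
    rw [hneg t ht] at this
    linarith
  · refine (hright.comp tendsto_neg_nhdsGT_neg).neg.congr' ?_
    filter_upwards [tendsto_neg_nhdsGT_neg.eventually hnear] with t ht
    rw [Function.comp_apply, ← hneg _ ht, neg_neg]
end

section
/- For all t in (−π/2, 0], the function ξ satisfies the quadratic lower bound ξ(t) ≥ −(π²/4 − 1) + (3 − π²/4)·t². -/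
open Real Set Filter Topology

/-- The Taylor polynomial of `sin` at `0` with `n` nonzero terms. -/
noncomputable def sinTaylor (n : ℕ) (x : ℝ) : ℝ :=
  ∑ k ∈ Finset.range n, (-1) ^ k * x ^ (2 * k + 1) / (2 * k + 1).factorial

/-- The Taylor polynomial of `cos` at `0` with `n` nonzero terms. -/
noncomputable def cosTaylor (n : ℕ) (x : ℝ) : ℝ :=
  ∑ k ∈ Finset.range n, (-1) ^ k * x ^ (2 * k) / (2 * k).factorial

theorem hasDerivAt_sinTaylor (n : ℕ) (x : ℝ) :
    HasDerivAt (sinTaylor n) (cosTaylor n x) x := by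
  unfold sinTaylor cosTaylor
  refine HasDerivAt.fun_sum fun k _ => ?_
  have h := ((hasDerivAt_pow (2 * k + 1) x).const_mul ((-1 : ℝ) ^ k)).div_const
    ((2 * k + 1).factorial : ℝ)
  refine h.congr_deriv ?_
  have hf : ((2 * k).factorial : ℝ) ≠ 0 := by positivity
  rw [Nat.factorial_succ, Nat.add_sub_cancel]
  push_cast
  field_simp

theorem hasDerivAt_cosTaylor (n : ℕ) (x : ℝ) :
    HasDerivAt (cosTaylor (n + 1)) (-sinTaylor n x) x := by
  have hfun : cosTaylor (n + 1) = fun y => (∑ k ∈ Finset.range n,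
      (-1) ^ (k + 1) * y ^ (2 * k + 2) / ((2 * k + 2).factorial : ℝ)) + 1 := by
    funext y
    simp [cosTaylor, Finset.sum_range_succ', mul_add]
  rw [hfun]
  unfold sinTaylor
  rw [← Finset.sum_neg_distrib]
  refine HasDerivAt.add_const _ (HasDerivAt.fun_sum fun k _ => ?_)
  have h := ((hasDerivAt_pow (2 * k + 2) x).const_mul ((-1 : ℝ) ^ (k + 1))).div_const
    ((2 * k + 2).factorial : ℝ)
  refine h.congr_deriv ?_
  have hf : ((2 * k + 1).factorial : ℝ) ≠ 0 := by positivity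
  rw [Nat.factorial_succ (2 * k + 1), show 2 * k + 2 - 1 = 2 * k + 1 from rfl]
  push_cast
  field_simp
  ring

theorem nonneg_of_hasDerivAt_nonneg {f f' : ℝ → ℝ} (hf : ∀ x, HasDerivAt f (f' x) x)
    (hf' : ∀ x, 0 ≤ x → 0 ≤ f' x) (h0 : f 0 = 0) {x : ℝ} (hx : 0 ≤ x) : 0 ≤ f x := by
  have hmono : MonotoneOn f (Ici 0) := by
    refine monotoneOn_of_hasDerivWithinAt_nonneg (f' := f') (convex_Ici 0)
      (fun y _ => (hf y).continuousAt.continuousWithinAt)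
      (fun y _ => (hf y).hasDerivWithinAt) fun y hy => hf' y ?_
    rw [interior_Ici] at hy
    exact le_of_lt hy
  simpa [h0] using hmono self_mem_Ici hx hx

/-- On the nonnegative reals, the error of the Taylor polynomials of `sin` and `cos` has the sign
of the first omitted term. -/
theorem taylor_error_sign (n : ℕ) :
    (∀ x, 0 ≤ x → 0 ≤ (-1) ^ (n + 1) * (cos x - cosTaylor (n + 1) x)) ∧
      ∀ x, 0 ≤ x → 0 ≤ (-1) ^ (n + 1) * (sin x - sinTaylor (n + 1) x) := by
  have hsin (m : ℕ) (h : ∀ x, 0 ≤ x → 0 ≤ (-1) ^ m * (cos x - cosTaylor m x)) (x : ℝ)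
      (hx : 0 ≤ x) : 0 ≤ (-1) ^ m * (sin x - sinTaylor m x) :=
    nonneg_of_hasDerivAt_nonneg
      (fun y => ((hasDerivAt_sin y).sub (hasDerivAt_sinTaylor m y)).const_mul _) h
      (by simp [sinTaylor]) hx
  induction n with
  | zero =>
    have hcos : ∀ x : ℝ, 0 ≤ x → 0 ≤ (-1) ^ (0 + 1) * (cos x - cosTaylor (0 + 1) x) :=
      fun x _ => by simp [cosTaylor, cos_le_one]
    exact ⟨hcos, hsin 1 hcos⟩
  | succ n ih =>
    have hcos : ∀ x, 0 ≤ x →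
        0 ≤ (-1) ^ (n + 1 + 1) * (cos x - cosTaylor (n + 1 + 1) x) := by
      intro x hx
      refine nonneg_of_hasDerivAt_nonneg
        (fun y => ((hasDerivAt_cos y).sub (hasDerivAt_cosTaylor (n + 1) y)).const_mul _)
        (fun y hy => ?_) ?_ hx
      · have := ih.2 y hy
        rw [pow_succ]
        linarith
      · simp [cosTaylor, Finset.sum_range_succ']
    exact ⟨hcos, hsin _ hcos⟩

theorem quadratic_gap_nonneg_of_sq_le_two {t : ℝ} (ht : 0 ≤ t) (ht2 : t ^ 2 ≤ 2) :
    0 ≤ 2 * t * sin t * cos t + t ^ 2 - π ^ 2 / 4 * sin t ^ 2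
      - (3 - π ^ 2 / 4) * t ^ 2 * cos t ^ 2 := by
  have hs := (taylor_error_sign 5).2 (2 * t) (by positivity)
  have hc := (taylor_error_sign 5).1 (2 * t) (by positivity)
  have hA1 : (2.4674 : ℝ) ≤ π ^ 2 / 4 := by nlinarith [pi_gt_d6]
  have hA2 : π ^ 2 / 4 ≤ 2.46742 := by nlinarith [pi_lt_d6, pi_pos]
  have hexp : 2 * t * sin t * cos t + t ^ 2 - π ^ 2 / 4 * sin t ^ 2
      - (3 - π ^ 2 / 4) * t ^ 2 * cos t ^ 2 = t * sin (2 * t) + t ^ 2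
      + (π ^ 2 / 4 / 2 - (3 - π ^ 2 / 4) / 2 * t ^ 2) * cos (2 * t) - π ^ 2 / 4 / 2
      - (3 - π ^ 2 / 4) / 2 * t ^ 2 := by
    rw [sin_two_mul, cos_two_mul, sin_sq]
    ring
  rw [hexp]
  generalize π ^ 2 / 4 = A at *
  norm_num [sinTaylor, cosTaylor, Finset.sum_range_succ, Nat.factorial] at hs hc
  have hcoef : 0 ≤ A / 2 - (3 - A) / 2 * t ^ 2 := by nlinarith
  have h1 := mul_le_mul_of_nonneg_left hs ht
  have h2 := mul_le_mul_of_nonneg_left hc hcoef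
  have hgap : 0 ≤ (t ^ 2) ^ 2 * (5 / 3 - 11 / 15 * t ^ 2 + 34 / 315 * (t ^ 2) ^ 2
      - 23 / 2835 * (t ^ 2) ^ 3 + 58 / 155925 * (t ^ 2) ^ 4 - A * (2 / 3 - 13 / 45 * t ^ 2
      + 13 / 315 * (t ^ 2) ^ 2 - 43 / 14175 * (t ^ 2) ^ 3 + 2 / 14175 * (t ^ 2) ^ 4)) := by
    refine mul_nonneg (by positivity) ?_
    have hu : 0 ≤ t ^ 2 := sq_nonneg t
    generalize t ^ 2 = u at hu ht2
    have hv : 0 ≤ 2 - u := by linarith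
    have b0 : 0 ≤ (2 - u) ^ 4 := by positivity
    have b1 : 0 ≤ u * (2 - u) ^ 3 := by positivity
    have b2 : 0 ≤ u ^ 2 * (2 - u) ^ 2 := by positivity
    have b3 : 0 ≤ u ^ 3 * (2 - u) := by positivity
    have b4 : 0 ≤ u ^ 4 := by positivity
    have hq : 0 ≤ 2 / 3 - 13 / 45 * u + 13 / 315 * u ^ 2 - 43 / 14175 * u ^ 3
        + 2 / 14175 * u ^ 4 := by
      linarith
    have h3 := mul_le_mul_of_nonneg_right hA2 hq
    linarith
  linarith

theorem quadratic_gap_nonneg_near_pi_div_two {x : ℝ} (hx : 0 ≤ x) (hx2 : x ≤ 0.16) :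
    0 ≤ (π - 2 * x) * sin x * cos x - (π * x - x ^ 2) * cos x ^ 2
      + (π ^ 2 / 4 - 2) * (π / 2 - x) ^ 2 * sin x ^ 2 := by
  have hs := (taylor_error_sign 1).2 x hx
  have hc := (taylor_error_sign 2).1 x hx
  norm_num [sinTaylor, cosTaylor, Finset.sum_range_succ, Nat.factorial] at hs hc
  have hp1 := pi_gt_d6
  have hp2 := pi_lt_d6
  have hA : (0.4674 : ℝ) ≤ π ^ 2 / 4 - 2 := by nlinarith
  have hcos : 0 ≤ cos x := cos_nonneg_of_mem_Icc ⟨by linarith, by linarith⟩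
  have hcos1 := cos_le_one x
  have hx3 : 0 ≤ x ^ 3 := by positivity
  have hbr : -(x ^ 2 * (1 - x)) ≤ (π - 2 * x) * sin x - (π * x - x ^ 2) * cos x := by
    have h1 : (π - 2 * x) * (x - x ^ 3 / 6) ≤ (π - 2 * x) * sin x :=
      mul_le_mul_of_nonneg_left (by linarith) (by linarith)
    have h2 : (π * x - x ^ 2) * cos x ≤ (π * x - x ^ 2) * (1 - x ^ 2 / 2 + x ^ 4 / 24) :=
      mul_le_mul_of_nonneg_left (by linarith) (by nlinarith)
    have h3 : 0 ≤ x ^ 3 * (π / 3 - 1 - x / 6 - π * x ^ 2 / 24 + x ^ 3 / 24) := by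
      refine mul_nonneg hx3 ?_
      have : x ^ 2 ≤ 0.0256 := by nlinarith
      nlinarith
    linarith
  have hbrc : -(x ^ 2 * (1 - x)) ≤ ((π - 2 * x) * sin x - (π * x - x ^ 2) * cos x) * cos x := by
    have h0 : 0 ≤ x ^ 2 * (1 - x) := mul_nonneg (by positivity) (by linarith)
    nlinarith
  have hsin2 : x ^ 2 * (1 - x ^ 2 / 3) ≤ sin x ^ 2 := by
    have h1 : 0 ≤ x * (1 - x ^ 2 / 6) := mul_nonneg hx (by nlinarith)
    have h2 := pow_le_pow_left₀ h1 (show x * (1 - x ^ 2 / 6) ≤ sin x by linarith) 2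
    nlinarith [sq_nonneg (x ^ 3)]
  have hq : (1.57 - x) ^ 2 ≤ (π / 2 - x) ^ 2 :=
    pow_le_pow_left₀ (by linarith) (by linarith) 2
  have hprod : 0.4674 * (1.57 - x) ^ 2 * (x ^ 2 * (1 - x ^ 2 / 3)) ≤
      (π ^ 2 / 4 - 2) * (π / 2 - x) ^ 2 * sin x ^ 2 := by
    have : 0 ≤ 1 - x ^ 2 / 3 := by nlinarith
    have : 0 ≤ π ^ 2 / 4 - 2 := by linarith
    gcongr
  have hlast : 0 ≤ x ^ 2 * (0.4674 * (1.57 - x) ^ 2 * (1 - x ^ 2 / 3) - (1 - x)) := by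
    refine mul_nonneg (by positivity) ?_
    have h1 : 1 - 0.0256 / 3 ≤ 1 - x ^ 2 / 3 := by nlinarith
    have h2 := mul_le_mul_of_nonneg_left h1 (show 0 ≤ 0.4674 * (1.57 - x) ^ 2 by positivity)
    nlinarith
  linarith

theorem quadratic_gap_nonneg {t : ℝ} (ht : 0 ≤ t) (ht2 : t ≤ π / 2) :
    0 ≤ 2 * t * sin t * cos t + t ^ 2 - π ^ 2 / 4 * sin t ^ 2
      - (3 - π ^ 2 / 4) * t ^ 2 * cos t ^ 2 := by
  rcases le_total (t ^ 2) 2 with h | h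
  · exact quadratic_gap_nonneg_of_sq_le_two ht h
  · have hx := quadratic_gap_nonneg_near_pi_div_two (x := π / 2 - t) (by linarith)
      (by nlinarith [pi_lt_d6])
    rw [sin_pi_div_two_sub, cos_pi_div_two_sub] at hx
    refine hx.trans_eq ?_
    linear_combination t ^ 2 * sin_sq_add_cos_sq t

theorem xi_quadratic_lower_bound :
    ∀ t ∈ Set.Ioc (-(Real.pi / 2)) (0 : ℝ),
      xi t ≥ -(Real.pi ^ 2 / 4 - 1) + (3 - Real.pi ^ 2 / 4) * t ^ 2 := by
  rintro t ⟨ht1, ht2⟩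
  have hc : 0 < cos t := cos_pos_of_mem_Ioo ⟨ht1, by linarith [pi_pos]⟩
  have h := quadratic_gap_nonneg (t := -t) (by linarith) (by linarith)
  rw [sin_neg, cos_neg] at h
  rw [ge_iff_le, xi, le_div_iff₀ (by positivity)]
  rw [neg_sq, neg_sq, sin_sq] at h
  linarith
end
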